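/- arXiv:1503.05069 — 4 statements merged into one kernel-verified Lean document; each statement's English description precedes it below -/
import Mathlib

section
/- Define L(y) := w(y) − 1 − (1/γ)(w(y)^γ − 1)·( w(y) − (γ−1) y (w(y)^γ − 1) ) for y > 0. Then there exist y₂ ∈ (0,∞) and two real sequences (γ_n)_{n≥2} and (δ_n)_{n≥2} such that γ₂ = (1/2) γ (γ−1) e^{2C₀}, δ₂ = −(1/2)(γ+1) e^{2C₀}, Σ_{n≥2} ( n|γ_n| + |δ_n| ) e^{−γ n y₂} < ∞, and L(y) = Σ_{n≥2} ( n γ_n y + δ_n ) e^{−γ n y} for every y ∈ [y₂,∞). -/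
open Filter Topology MeasureTheory Set

theorem AnalyticAt.dslope_self {f : ℝ → ℝ} {a : ℝ} (hf : AnalyticAt ℝ f a) :
    AnalyticAt ℝ (dslope f a) a := by
  obtain ⟨p, hp⟩ := hf
  exact ⟨_, hp.has_fpower_series_dslope_fslope⟩

/-- The integral from `0` of a function analytic at `0` is analytic at `0`. -/
theorem AnalyticAt.intervalIntegral_zero {h : ℝ → ℝ} (hh : AnalyticAt ℝ h 0) :
    AnalyticAt ℝ (fun v => ∫ t in (0:ℝ)..v, h t) 0 := by
  obtain ⟨p, hp⟩ := hh
  rw [hasFPowerSeriesAt_iff] at hp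
  let c : ℕ → ℝ := fun n => p.coeff (n - 1) / n
  refine ⟨FormalMultilinearSeries.ofScalars ℝ c, ?_⟩
  rw [hasFPowerSeriesAt_iff]
  obtain ⟨r, hr, hball⟩ := Metric.eventually_nhds_iff.1 hp
  refine Metric.eventually_nhds_iff.2 ⟨r, hr, fun v hv => ?_⟩
  simp only [zero_add, smul_eq_mul, FormalMultilinearSeries.coeff_ofScalars] at hball ⊢
  have habs : ∀ t ∈ uIoc 0 v, |t| ≤ |v| := fun t ht => by
    simpa using abs_sub_left_of_mem_uIcc (uIoc_subset_uIcc ht)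
  have hsum : Summable fun n => |v| ^ n * |p.coeff n| := by
    simpa [abs_mul] using (hball hv).summable.abs
  have key : HasSum (fun n => ∫ t in (0:ℝ)..v, t ^ n * p.coeff n) (∫ t in (0:ℝ)..v, h t) := by
    refine intervalIntegral.hasSum_integral_of_dominated_convergence
      (fun n _ => |v| ^ n * |p.coeff n|) (fun n => ?_) (fun n => ?_) ?_ ?_ ?_
    · exact (by fun_prop : Continuous fun t : ℝ => t ^ n * p.coeff n).aestronglyMeasurable
    · refine .of_forall fun t ht => ?_
      rw [Real.norm_eq_abs, abs_mul, abs_pow]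
      exact mul_le_mul_of_nonneg_right (pow_le_pow_left₀ (abs_nonneg t) (habs t ht) n)
        (abs_nonneg _)
    · exact .of_forall fun _ _ => hsum
    · exact intervalIntegrable_const
    · refine .of_forall fun t ht => hball ?_
      rw [dist_zero_right, Real.norm_eq_abs] at hv ⊢
      exact (habs t ht).trans_lt hv
  refine (hasSum_nat_add_iff' 1).1 ?_
  have hterm : (fun n => v ^ (n + 1) * c (n + 1)) =
      fun n => ∫ t in (0:ℝ)..v, t ^ n * p.coeff n := by
    ext n
    rw [intervalIntegral.integral_mul_const, integral_pow]
    simp only [c, Nat.add_sub_cancel, Nat.cast_add, Nat.cast_one, ne_eq, Nat.add_eq_zero_iff,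
      one_ne_zero, and_false, not_false_eq_true, zero_pow, sub_zero]
    ring
  have hzero : ∑ i ∈ Finset.range 1, v ^ i * c i = 0 := by simp [c]
  rw [hterm, hzero, sub_zero]
  exact key

/-- One-dimensional analytic inverse function theorem at a fixed point with unit derivative. -/
theorem AnalyticAt.exists_local_leftInverse {φ : ℝ → ℝ} (hφ : AnalyticAt ℝ φ 0) (h0 : φ 0 = 0)
    (h1 : deriv φ 0 = 1) :
    ∃ ψ : ℝ → ℝ, AnalyticAt ℝ ψ 0 ∧ ψ 0 = 0 ∧ deriv ψ 0 = 1 ∧ ∀ᶠ v in 𝓝 0, ψ (φ v) = v := by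
  have hd : HasStrictDerivAt φ 1 0 := h1 ▸ hφ.hasStrictDerivAt
  have hne : (1:ℝ) ≠ 0 := one_ne_zero
  let i := ContinuousLinearEquiv.unitsEquivAut ℝ (Units.mk0 (1:ℝ) hne)
  have hs : HasStrictFDerivAt φ (i : ℝ →L[ℝ] ℝ) 0 := hd.hasStrictFDerivAt_equiv hne
  refine ⟨hs.localInverse φ i 0, ?_, ?_, ?_, hs.eventually_left_inverse⟩
  · have := (hs.toOpenPartialHomeomorph φ).analyticAt_symm' (i := i)
      hs.mem_toOpenPartialHomeomorph_source hφ hs.hasFDerivAt.fderiv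
    simp only [HasStrictFDerivAt.toOpenPartialHomeomorph_coe, h0] at this
    exact this
  · simpa [h0] using hs.localInverse_apply_image
  · have := (hd.to_localInverse hne).hasDerivAt.deriv
    rw [h0] at this
    simpa using this

/-- The power series of an analytic function evaluated at small points. -/
theorem AnalyticAt.exists_hasSum {A : ℝ → ℝ} (hA : AnalyticAt ℝ A 0) :
    ∃ a : ℕ → ℝ, a 0 = A 0 ∧ ∀ᶠ z in 𝓝 (0:ℝ), HasSum (fun n => a n * z ^ n) (A z) := by
  obtain ⟨p, hp⟩ := hA
  refine ⟨p.coeff, hp.coeff_zero 1, ?_⟩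
  filter_upwards [hasFPowerSeriesAt_iff.1 hp] with z hz
  simpa [mul_comm] using hz

theorem deriv_dslope_one_add_rpow (γ : ℝ) :
    deriv (dslope (fun x : ℝ => (1 + x) ^ γ) 0) 0 = γ * (γ - 1) / 2 := by
  have h := (Real.one_add_rpow_hasFPowerSeriesAt_zero (a := γ)).has_fpower_series_dslope_fslope
  have h2 := h.deriv
  change _ = (FormalMultilinearSeries.fslope _).coeff 1 at h2
  rw [h2, FormalMultilinearSeries.coeff_fslope, binomialSeries,
    FormalMultilinearSeries.coeff_ofScalars]
  have := Ring.descPochhammer_eq_factorial_smul_choose γ 2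
  simp [descPochhammer_succ_right, Polynomial.smeval_mul, Polynomial.smeval_sub] at this
  change Ring.choose γ 2 = _
  linarith

section Slope

variable {γ : ℝ}

theorem mul_dslope_one_add_rpow (γ u : ℝ) :
    u * dslope (fun x : ℝ => (1 + x) ^ γ) 0 u = (1 + u) ^ γ - 1 := by
  simpa using sub_smul_dslope (fun x : ℝ => (1 + x) ^ γ) 0 u

theorem analyticAt_dslope_one_add_rpow (γ : ℝ) :
    AnalyticAt ℝ (dslope (fun x : ℝ => (1 + x) ^ γ) 0) 0 :=
  AnalyticAt.dslope_self ⟨_, Real.one_add_rpow_hasFPowerSeriesAt_zero⟩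

theorem dslope_one_add_rpow_zero (γ : ℝ) : dslope (fun x : ℝ => (1 + x) ^ γ) 0 0 = γ := by
  rw [dslope_same]
  have h : HasDerivAt (fun x : ℝ => (1 + x) ^ γ) (1 * γ * (1 + 0) ^ (γ - 1)) 0 :=
    ((hasDerivAt_id (0:ℝ)).const_add 1).rpow_const (by simp)
  simpa using h.deriv

theorem dslope_one_add_rpow_pos (hγ : 1 < γ) {u : ℝ} (hu : 0 ≤ u) :
    0 < dslope (fun x : ℝ => (1 + x) ^ γ) 0 u := by
  rcases hu.eq_or_lt with rfl | hu
  · rw [dslope_one_add_rpow_zero]; linarith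
  · have h := one_add_mul_self_le_rpow_one_add (by linarith : -1 ≤ u) hγ.le
    have h2 := mul_dslope_one_add_rpow γ u
    have h3 : 0 < γ * u := by positivity
    exact pos_of_mul_pos_right (h2 ▸ by linarith) hu.le

/-- The regular part of `γ / ((1 + u) ^ γ - 1)` at `u = 0`, up to sign:
`γ / ((1 + u) ^ γ - 1) = 1 / u - regularPart γ u`. -/
noncomputable def regularPart (γ u : ℝ) : ℝ :=
  dslope (dslope (fun x : ℝ => (1 + x) ^ γ) 0) 0 u / dslope (fun x : ℝ => (1 + x) ^ γ) 0 u

theorem analyticAt_regularPart (hγ : 1 < γ) : AnalyticAt ℝ (regularPart γ) 0 :=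
  (analyticAt_dslope_one_add_rpow γ).dslope_self.div (analyticAt_dslope_one_add_rpow γ)
    (dslope_one_add_rpow_pos hγ le_rfl).ne'

theorem continuousOn_regularPart (hγ : 1 < γ) : ContinuousOn (regularPart γ) (Ici 0) := by
  have hs : Ioi (-1:ℝ) ∈ 𝓝 (0:ℝ) := Ioi_mem_nhds (by norm_num)
  have hsub : Ici (0:ℝ) ⊆ Ioi (-1) := fun x hx => lt_of_lt_of_le (by norm_num) (mem_Ici.1 hx)
  have h1 : ContinuousOn (dslope (fun x : ℝ => (1 + x) ^ γ) 0) (Ioi (-1)) := by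
    refine (continuousOn_dslope hs).2 ⟨?_, ?_⟩
    · exact (by fun_prop : ContinuousOn (fun x : ℝ => 1 + x) (Ioi (-1))).rpow_const
        fun x hx => .inr (by linarith)
    · exact (Real.one_add_rpow_hasFPowerSeriesAt_zero (a := γ)).analyticAt.differentiableAt
  have h2 : ContinuousOn (dslope (dslope (fun x : ℝ => (1 + x) ^ γ) 0) 0) (Ioi (-1)) :=
    (continuousOn_dslope hs).2 ⟨h1, (analyticAt_dslope_one_add_rpow γ).differentiableAt⟩
  exact (h2.mono hsub).div (h1.mono hsub) fun x hx => (dslope_one_add_rpow_pos hγ hx).ne'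

theorem one_add_rpow_sub_one_pos (hγ : 1 < γ) {u : ℝ} (hu : 0 < u) : 0 < (1 + u) ^ γ - 1 := by
  rw [← mul_dslope_one_add_rpow]
  exact mul_pos hu (dslope_one_add_rpow_pos hγ hu.le)

theorem regularPart_of_pos (hγ : 1 < γ) {u : ℝ} (hu : 0 < u) :
    regularPart γ u = ((1 + u) ^ γ - 1 - γ * u) / (u * ((1 + u) ^ γ - 1)) := by
  have h1 := mul_dslope_one_add_rpow γ u
  have h2 := sub_smul_dslope (dslope (fun x : ℝ => (1 + x) ^ γ) 0) 0 u
  have hg := dslope_one_add_rpow_pos hγ hu.le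
  rw [dslope_one_add_rpow_zero, sub_zero, smul_eq_mul] at h2
  rw [← h1, regularPart, div_eq_div_iff hg.ne' (by positivity)]
  linear_combination (u * dslope (fun x : ℝ => (1 + x) ^ γ) 0 u) * h2

theorem mul_inv_one_add_rpow_sub_one (hγ : 1 < γ) {u : ℝ} (hu : 0 < u) :
    γ * ((1 + u) ^ γ - 1)⁻¹ = u⁻¹ - regularPart γ u := by
  have h := one_add_rpow_sub_one_pos hγ hu
  rw [regularPart_of_pos hγ hu]
  field_simp
  ring

theorem mul_integral_Ioi_one_add (hγ : 1 < γ) {v : ℝ} (hv : 0 < v) (hv1 : v ≤ 1)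
    (hF : IntegrableOn (fun u : ℝ => (u ^ γ - 1)⁻¹) (Ioi (1 + v))) :
    γ * ∫ u in Ioi (1 + v), (u ^ γ - 1)⁻¹ =
      γ * (∫ u in Ioi (1:ℝ), ((u + 1) ^ γ - 1)⁻¹)
        - (∫ u in (0:ℝ)..1, if u = 0 then (γ - 1) / 2
            else ((1 + u) ^ γ - 1 - γ * u) / (u * ((1 + u) ^ γ - 1)))
        - Real.log v + ∫ u in (0:ℝ)..v, regularPart γ u := by
  have hshift : (∫ u in Ioi (1:ℝ), ((u + 1) ^ γ - 1)⁻¹) = ∫ u in Ioi (2:ℝ), (u ^ γ - 1)⁻¹ := by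
    have h := (measurePreserving_add_right volume (1:ℝ)).setIntegral_preimage_emb
      (measurableEmbedding_addRight (1:ℝ)) (fun u : ℝ => (u ^ γ - 1)⁻¹) (Ioi 2)
    have hpre : (fun x : ℝ => x + 1) ⁻¹' Ioi 2 = Ioi 1 := by
      ext x; simp only [mem_preimage, mem_Ioi]; constructor <;> intro h <;> linarith
    rwa [hpre] at h
  have hsplit := intervalIntegral.integral_interval_add_Ioi hF
    (hF.mono_set (Ioi_subset_Ioi (by linarith : 1 + v ≤ 2)))
  have hcomp : (∫ u in (1 + v)..2, (u ^ γ - 1)⁻¹) = ∫ u in v..1, ((1 + u) ^ γ - 1)⁻¹ := by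
    rw [intervalIntegral.integral_comp_add_left (fun u : ℝ => (u ^ γ - 1)⁻¹) 1]
    norm_num
  have hI : ∀ a b : ℝ, 0 ≤ a → 0 ≤ b → IntervalIntegrable (regularPart γ) volume a b :=
    fun a b ha hb => ((continuousOn_regularPart hγ).mono
      fun x hx => (le_min ha hb).trans hx.1).intervalIntegrable
  have hmain : γ * (∫ u in v..1, ((1 + u) ^ γ - 1)⁻¹) =
      -Real.log v - ∫ u in v..1, regularPart γ u := by
    rw [← intervalIntegral.integral_const_mul,
      intervalIntegral.integral_congr (g := fun u => u⁻¹ - regularPart γ u),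
      intervalIntegral.integral_sub, integral_inv_of_pos hv one_pos, one_div, Real.log_inv]
    · exact intervalIntegral.intervalIntegrable_inv
        (fun x hx => ((lt_min hv one_pos).trans_le hx.1).ne') continuousOn_id
    · exact hI v 1 hv.le zero_le_one
    · exact fun u hu => mul_inv_one_add_rpow_sub_one hγ ((lt_min hv one_pos).trans_le hu.1)
  have hadd := intervalIntegral.integral_add_adjacent_intervals
    (hI 0 v le_rfl hv.le) (hI v 1 hv.le zero_le_one)
  have hconst : (∫ u in (0:ℝ)..1, if u = 0 then (γ - 1) / 2
      else ((1 + u) ^ γ - 1 - γ * u) / (u * ((1 + u) ^ γ - 1))) =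
      ∫ u in (0:ℝ)..1, regularPart γ u := by
    refine intervalIntegral.integral_congr_ae (.of_forall fun u hu => ?_)
    rw [uIoc_of_le zero_le_one] at hu
    rw [if_neg hu.1.ne', regularPart_of_pos hγ hu.1]
  rw [hshift, ← hsplit, hcomp, mul_add, hmain, hconst]
  linarith

end Slope

/-- Solutions of the autonomous equation with rate `1 - w ^ γ` staying above `1` converge to `1` at infinity. -/
theorem tendsto_sub_one_of_hasDerivAt {γ : ℝ} (hγ : 1 < γ) {w : ℝ → ℝ}
    (hw_gt : ∀ y ∈ Ioi (0:ℝ), 1 < w y)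
    (hw_deriv : ∀ y ∈ Ioi (0:ℝ), HasDerivAt w (-(w y ^ γ - 1)) y) :
    Tendsto (fun y => w y - 1) atTop (𝓝 0) := by
  have hd : ∀ y ∈ Ioi (0:ℝ), HasDerivAt (fun y => (w y - 1) * Real.exp (γ * y))
      (-(w y ^ γ - 1) * Real.exp (γ * y) + (w y - 1) * (Real.exp (γ * y) * (γ * 1))) y :=
    fun y hy => ((hw_deriv y hy).sub_const 1).mul (((hasDerivAt_id y).const_mul γ).exp)
  have hanti : AntitoneOn (fun y => (w y - 1) * Real.exp (γ * y)) (Ioi 0) := by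
    refine antitoneOn_of_deriv_nonpos (convex_Ioi 0)
      (fun y hy => (hd y hy).continuousAt.continuousWithinAt)
      (fun y hy => (hd y (interior_subset hy)).differentiableAt.differentiableWithinAt)
      fun y hy => ?_
    have hy := interior_subset hy
    rw [(hd y hy).deriv]
    have hb := one_add_mul_self_le_rpow_one_add (by linarith [hw_gt y hy] : -1 ≤ w y - 1) hγ.le
    rw [add_sub_cancel] at hb
    nlinarith [Real.exp_pos (γ * y)]
  have hlim : Tendsto (fun y => (w 1 - 1) * Real.exp (γ * 1) * Real.exp (-(γ * y))) atTop
      (𝓝 ((w 1 - 1) * Real.exp (γ * 1) * 0)) :=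
    (Real.tendsto_exp_neg_atTop_nhds_zero.comp
      (tendsto_id.const_mul_atTop (by linarith : 0 < γ))).const_mul _
  rw [mul_zero] at hlim
  refine squeeze_zero' ?_ ?_ hlim
  · filter_upwards [eventually_gt_atTop 0] with y hy
    linarith [hw_gt y hy]
  · filter_upwards [eventually_ge_atTop 1] with y hy
    have h : (w y - 1) * Real.exp (γ * y) ≤ (w 1 - 1) * Real.exp (γ * 1) :=
      hanti (mem_Ioi.2 one_pos) (mem_Ioi.2 (one_pos.trans_le hy)) hy
    rwa [Real.exp_neg, ← div_eq_mul_inv, le_div_iff₀ (Real.exp_pos _)]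

/-- Lemma 4.7.  Fix `γ ∈ (1,2]`, let `w` be as in the context and
`C₀` as defined there.  With
`L(y) := w(y) − 1 − (1/γ)(w(y)^γ − 1)(w(y) − (γ−1) y (w(y)^γ − 1))`, there exist
`y₂ > 0` and sequences `(γ_n)_{n≥2}`, `(δ_n)_{n≥2}` with
`γ₂ = (1/2)γ(γ−1)e^{2C₀}`, `δ₂ = −(1/2)(γ+1)e^{2C₀}`,
`Σ_{n≥2} (n|γ_n| + |δ_n|) e^{−γny₂} < ∞`, and
`L(y) = Σ_{n≥2} (nγ_n y + δ_n) e^{−γny}` for all `y ≥ y₂`. -/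
theorem stmt14 (γ : ℝ) (hγ1 : 1 < γ) (hγ2 : γ ≤ 2)
    (w : ℝ → ℝ)
    (hw_gt : ∀ y ∈ Set.Ioi (0:ℝ), 1 < w y)
    (hw_int : ∀ y ∈ Set.Ioi (0:ℝ), (∫ u in Set.Ioi (w y), (u ^ γ - 1)⁻¹) = y)
    (hw_deriv : ∀ y ∈ Set.Ioi (0:ℝ), HasDerivAt w (-(w y ^ γ - 1)) y)
    (C₀ : ℝ)
    (hC₀ : C₀ = γ * (∫ u in Set.Ioi (1:ℝ), ((u + 1) ^ γ - 1)⁻¹)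
      - ∫ u in (0:ℝ)..1,
          (if u = 0 then (γ - 1)/2
            else ((1 + u) ^ γ - 1 - γ * u) / (u * ((1 + u) ^ γ - 1))))
    (L : ℝ → ℝ)
    (hL : ∀ y ∈ Set.Ioi (0:ℝ),
      L y = w y - 1
        - (1/γ) * (w y ^ γ - 1) * (w y - (γ - 1) * y * (w y ^ γ - 1))) :
    ∃ y₂ : ℝ, 0 < y₂ ∧ ∃ gam del : ℕ → ℝ,
      gam 2 = (1/2) * γ * (γ - 1) * Real.exp (2 * C₀) ∧
      del 2 = -(1/2) * (γ + 1) * Real.exp (2 * C₀) ∧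
      Summable (fun n : ℕ =>
        (((n:ℝ) + 2) * |gam (n + 2)| + |del (n + 2)|)
          * Real.exp (-(γ * ((n:ℝ) + 2) * y₂))) ∧
      ∀ y : ℝ, y₂ ≤ y →
        L y = ∑' n : ℕ,
          (((n:ℝ) + 2) * gam (n + 2) * y + del (n + 2))
            * Real.exp (-(γ * ((n:ℝ) + 2) * y)) := by
  have hγ0 : 0 < γ := by linarith
  set g := dslope (fun x : ℝ => (1 + x) ^ γ) 0
  have hgA : AnalyticAt ℝ g 0 := analyticAt_dslope_one_add_rpow γ
  have hg0 : g 0 = γ := dslope_one_add_rpow_zero γ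
  -- the linearizing coordinate `φ` and its inverse `ψ`
  let E : ℝ → ℝ := fun v => Real.exp (-∫ t in (0:ℝ)..v, regularPart γ t)
  have hE : AnalyticAt ℝ E 0 := (analyticAt_regularPart hγ1).intervalIntegral_zero.neg.rexp
  have hE0 : E 0 = 1 := by simp [E]
  have hφ : AnalyticAt ℝ (fun v => v * E v) 0 := analyticAt_id.mul hE
  have hφ1 : deriv (fun v => v * E v) 0 = 1 := by
    have h : HasDerivAt (fun v => v * E v) (1 * E 0 + 0 * deriv E 0) 0 :=
      (hasDerivAt_id' (0:ℝ)).mul hE.differentiableAt.hasDerivAt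
    rw [h.deriv, hE0]
    ring
  obtain ⟨ψ, hψ, hψ0, hψ1, hψφ⟩ := hφ.exists_local_leftInverse (by simp) hφ1
  let χ := dslope ψ 0
  have hχ0 : χ 0 = 1 := by simp [χ, hψ1]
  have hχ : ∀ z, z * χ z = ψ z := fun z => by simpa [hψ0] using sub_smul_dslope ψ 0 z
  let N : ℝ → ℝ := fun v => 1 - g v * (1 + v) / γ
  have hN : AnalyticAt ℝ N 0 :=
    analyticAt_const.sub ((hgA.mul (analyticAt_const.add analyticAt_id)).div analyticAt_const
      hγ0.ne')
  have hN0 : N 0 = 0 := by simp [N, hg0, hγ0.ne']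
  let m := dslope N 0
  have hm : ∀ v, v * m v = N v := fun v => by simpa [hN0] using sub_smul_dslope N 0 v
  have hm0 : m 0 = -(1/2) * (γ + 1) := by
    have hg' : HasDerivAt g (γ * (γ - 1) / 2) 0 :=
      deriv_dslope_one_add_rpow γ ▸ hgA.differentiableAt.hasDerivAt
    have h := ((hg'.mul ((hasDerivAt_id (0:ℝ)).const_add 1)).div_const γ).const_sub 1
    have h' : m 0 = _ := (dslope_same N 0).trans h.deriv
    rw [h', hg0]
    simp only [id]
    field_simp
    ring
  have hmψ : AnalyticAt ℝ (fun z => m (ψ z)) 0 :=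
    AnalyticAt.comp (by rw [hψ0]; exact hN.dslope_self) hψ
  have hgψ : AnalyticAt ℝ (fun z => g (ψ z)) 0 := AnalyticAt.comp (by rw [hψ0]; exact hgA) hψ
  obtain ⟨a, ha0, ha⟩ := (hmψ.mul (hψ.dslope_self.pow 2)).exists_hasSum
  obtain ⟨b, hb0, hb⟩ :=
    ((analyticAt_const (v := (γ - 1) / γ)).mul
      ((hgψ.pow 2).mul (hψ.dslope_self.pow 2))).exists_hasSum
  have hwlim := tendsto_sub_one_of_hasDerivAt hγ1 hw_gt hw_deriv
  have hzlim : Tendsto (fun y => Real.exp (C₀ - γ * y)) atTop (𝓝 0) :=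
    Real.tendsto_exp_atBot.comp (tendsto_atBot_add_const_left _ C₀
      (tendsto_neg_atTop_atBot.comp (tendsto_id.const_mul_atTop hγ0)))
  obtain ⟨Y, hY⟩ := eventually_atTop.1 ((hwlim.eventually hψφ).and
    ((hwlim.eventually (eventually_le_nhds one_pos)).and
      ((hzlim.eventually ha).and (hzlim.eventually hb))))
  have hz : ∀ (n : ℕ) (y : ℝ), Real.exp (C₀ - γ * y) ^ (n + 2) =
      Real.exp (((n:ℝ) + 2) * C₀) * Real.exp (-(γ * ((n:ℝ) + 2) * y)) := fun n y => by
    rw [← Real.exp_nat_mul, ← Real.exp_add]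
    congr 1
    push_cast
    ring
  refine ⟨max Y 1, by positivity, fun n => b (n - 2) * Real.exp (n * C₀) / n,
    fun n => a (n - 2) * Real.exp (n * C₀), ?_, ?_, ?_, fun y hy => ?_⟩
  · simp only [le_refl, Nat.sub_eq_zero_of_le, hb0, Pi.mul_apply, Pi.pow_apply, hψ0, hg0]
    change (γ - 1) / γ * (γ ^ 2 * χ 0 ^ 2) * _ / _ = _
    rw [hχ0]
    field_simp
    norm_num
    ring_nf
  · simp only [le_refl, Nat.sub_eq_zero_of_le, ha0, Pi.mul_apply, Pi.pow_apply, hψ0, hm0]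
    change _ * χ 0 ^ 2 * _ = _
    rw [hχ0]
    norm_num
  · obtain ⟨-, -, ha, hb⟩ := hY (max Y 1) (le_max_left _ _)
    refine ((hb.summable.abs.add ha.summable.abs).mul_left
      (Real.exp (C₀ - γ * max Y 1) ^ 2)).congr fun n => ?_
    have hn : (0:ℝ) < (n:ℝ) + 2 := by positivity
    simp only [Nat.add_sub_cancel, Nat.cast_add, Nat.cast_ofNat, abs_mul, abs_div, abs_of_pos hn,
      abs_pow, Real.abs_exp]
    rw [mul_div_cancel₀ _ hn.ne']
    linear_combination (|b n| + |a n|) * hz n (max Y 1)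
  · have hy0 : 0 < y := one_pos.trans_le ((le_max_right Y 1).trans hy)
    obtain ⟨hinv, hv1, ha, hb⟩ := hY y ((le_max_left Y 1).trans hy)
    set v := w y - 1 with hv
    have hwv : w y = 1 + v := by simp [hv]
    have hv0 : 0 < v := by linarith [hw_gt y hy0]
    have hF := hw_int y hy0
    rw [hwv] at hF
    have hI : IntegrableOn (fun u : ℝ => (u ^ γ - 1)⁻¹) (Ioi (1 + v)) := by
      by_contra hni
      exact hy0.ne (hF.symm.trans (integral_undef hni)).symm
    have hflow := mul_integral_Ioi_one_add hγ1 hv0 hv1 hI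
    rw [hF, ← hC₀] at hflow
    set z := Real.exp (C₀ - γ * y) with hzdef
    have hzv : v * E v = z := by
      have hexp : C₀ - γ * y = Real.log v + -∫ t in (0:ℝ)..v, regularPart γ t := by
        rw [hflow]
        ring
      rw [hzdef, hexp, Real.exp_add, Real.exp_log hv0]
    rw [hzv] at hinv
    have hLy : L y = z ^ 2 * (m (ψ z) * χ z ^ 2) +
        y * z ^ 2 * ((γ - 1) / γ * (g (ψ z) ^ 2 * χ z ^ 2)) := by
      have hgv : v * g v = (1 + v) ^ γ - 1 := mul_dslope_one_add_rpow γ v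
      have hmv := hm v
      have hχz := hχ z
      rw [hinv] at hχz ⊢
      have hsq : v ^ 2 = z ^ 2 * χ z ^ 2 := by linear_combination -(z * χ z + v) * hχz
      rw [hL y hy0, hwv, ← hgv]
      linear_combination (-v) * hmv + (m v + y * ((γ - 1) / γ) * g v ^ 2) * hsq
    rw [hLy]
    refine ((ha.mul_left (z ^ 2)).add (hb.mul_left (y * z ^ 2))).tsum_eq.symm.trans
      (tsum_congr fun n => ?_)
    have hn : (n:ℝ) + 2 ≠ 0 := by positivity
    simp only [Nat.add_sub_cancel, Nat.cast_add, Nat.cast_ofNat]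
    rw [mul_div_cancel₀ _ hn]
    linear_combination (y * b n + a n) * hz n y
end

section
/- Let γ ∈ (1,2) and set λ_cr := ((π/γ)/sin(π/γ))^{γ/(γ−1)}. Then there exists a strictly decreasing continuous function r : [0,λ_cr] → [0,(γ−1)^{−1/(γ−1)}] such that ∫_{r(λ)}^∞ du/(u^γ + λ) = 1 for every λ ∈ [0,λ_cr], with r(0) = (γ−1)^{−1/(γ−1)} and r(λ_cr) = 0. Moreover r is differentiable on (0,λ_cr) and, for every λ ∈ (0,λ_cr): −r'(λ) = ((γ−1)/γ) λ^{−1} r(λ)^γ − (1/γ) λ^{−1} r(λ) + (γ−1)/γ. -/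
open MeasureTheory Set Filter Topology

/-- The integrand `(u ^ γ + l)⁻¹` is integrable at infinity, and also near the left endpoint as soon
as that endpoint or `l` is positive. -/
lemma integrableOn_Ioi_inv_rpow_add {γ x l : ℝ} (hγ : 1 < γ) (hx : 0 ≤ x) (hl : 0 ≤ l)
    (h : 0 < x ∨ 0 < l) : IntegrableOn (fun u : ℝ => (u ^ γ + l)⁻¹) (Ioi x) := by
  have hpos : ∀ c : ℝ, 0 < c → IntegrableOn (fun u : ℝ => (u ^ γ + l)⁻¹) (Ioi c) := by
    intro c hc
    refine Integrable.mono' (integrableOn_Ioi_rpow_of_lt (a := -γ) (by linarith) hc)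
      (by fun_prop) ?_
    refine (ae_restrict_mem measurableSet_Ioi).mono fun u hu => ?_
    have hu0 : 0 < u := hc.trans hu
    have hup : 0 < u ^ γ := Real.rpow_pos_of_pos hu0 γ
    rw [Real.norm_of_nonneg (by positivity), Real.rpow_neg hu0.le]
    gcongr
    linarith
  rcases h with h | h
  · exact hpos x h
  · have hunion : Ioi x = Ioc x (x + 1) ∪ Ioi (x + 1) :=
      (Ioc_union_Ioi_eq_Ioi (by linarith)).symm
    rw [hunion]
    refine IntegrableOn.union ?_ (hpos _ (by linarith))
    refine (ContinuousOn.integrableOn_Icc ?_).mono_set Ioc_subset_Icc_self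
    refine ContinuousOn.inv₀ ?_ fun u hu => ?_
    · exact ((Real.continuous_rpow_const (by linarith)).add continuous_const).continuousOn
    · have : 0 ≤ u ^ γ := Real.rpow_nonneg (hx.trans hu.1) γ
      positivity

/-- The tail integral of `(u ^ γ + l)⁻¹` strictly decreases in `l` and decreases in the left
endpoint. -/
lemma integral_Ioi_inv_rpow_add_lt {γ x₁ x₂ l₁ l₂ : ℝ} (hγ : 1 < γ) (hx₁ : 0 ≤ x₁) (hx : x₁ ≤ x₂)
    (hl₁ : 0 ≤ l₁) (hl : l₁ < l₂) (h : 0 < x₁ ∨ 0 < l₁) :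
    ∫ u in Ioi x₂, (u ^ γ + l₂)⁻¹ < ∫ u in Ioi x₁, (u ^ γ + l₁)⁻¹ := by
  have hi₁ := integrableOn_Ioi_inv_rpow_add hγ hx₁ hl₁ h
  have hi₂ := integrableOn_Ioi_inv_rpow_add hγ (hx₁.trans hx) (hl₁.trans hl.le)
    (Or.inr (hl₁.trans_lt hl))
  have hi₁' := hi₁.mono_set (Ioi_subset_Ioi hx)
  have hlt : ∀ u ∈ Ioi x₂, (u ^ γ + l₂)⁻¹ < (u ^ γ + l₁)⁻¹ := by
    intro u hu
    have hup : 0 < u ^ γ := Real.rpow_pos_of_pos ((hx₁.trans hx).trans_lt hu) γ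
    gcongr
  calc ∫ u in Ioi x₂, (u ^ γ + l₂)⁻¹ < ∫ u in Ioi x₂, (u ^ γ + l₁)⁻¹ := by
        rw [← sub_pos, ← integral_sub hi₁' hi₂, setIntegral_pos_iff_support_of_nonneg_ae]
        · refine lt_of_lt_of_le ?_ (measure_mono (s := Ioi x₂) fun u hu =>
            ⟨(sub_pos.2 (hlt u hu)).ne', hu⟩)
          simp
        · exact (ae_restrict_mem measurableSet_Ioi).mono fun u hu => (sub_pos.2 (hlt u hu)).le
        · exact hi₁'.sub hi₂
    _ ≤ ∫ u in Ioi x₁, (u ^ γ + l₁)⁻¹ := by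
        refine setIntegral_mono_set hi₁ ?_ (Ioi_subset_Ioi hx).eventuallyLE
        refine (ae_restrict_mem measurableSet_Ioi).mono fun u hu => ?_
        have : 0 ≤ u ^ γ := Real.rpow_nonneg (hx₁.trans (le_of_lt hu)) γ
        simp only [Pi.zero_apply]
        positivity

lemma integral_Ioi_inv_rpow_add_one {γ : ℝ} (hγ : 1 < γ) :
    ∫ v in Ioi (0 : ℝ), (v ^ γ + 1)⁻¹ = (Real.pi / γ) / Real.sin (Real.pi / γ) := by
  have hγ0 : 0 < γ := by linarith
  have hexp : ∀ v ∈ Ioi (0 : ℝ),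
      ∫ s in Ioi (0 : ℝ), Real.exp (-(v ^ γ + 1) * s) = (v ^ γ + 1)⁻¹ := by
    intro v hv
    have hvp : 0 < v ^ γ := Real.rpow_pos_of_pos hv γ
    rw [integral_exp_mul_Ioi (by linarith)]
    simp [neg_div, div_neg, -neg_add_rev]
  have hint : Integrable (Function.uncurry fun v s : ℝ => Real.exp (-(v ^ γ + 1) * s))
      ((volume.restrict (Ioi 0)).prod (volume.restrict (Ioi 0))) := by
    rw [integrable_prod_iff
      (Measurable.aestronglyMeasurable (by unfold Function.uncurry; fun_prop))]
    constructor
    · refine (ae_restrict_mem measurableSet_Ioi).mono fun v hv => ?_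
      have hvp : 0 < v ^ γ := Real.rpow_pos_of_pos hv γ
      exact integrableOn_exp_mul_Ioi (a := -(v ^ γ + 1)) (by linarith) 0
    · simp only [Function.uncurry_apply_pair, Real.norm_eq_abs, Real.abs_exp]
      refine Integrable.congr (integrableOn_Ioi_inv_rpow_add hγ le_rfl zero_le_one
        (Or.inr one_pos)) ?_
      exact (ae_restrict_mem measurableSet_Ioi).mono fun v hv => (hexp v hv).symm
  calc ∫ v in Ioi (0 : ℝ), (v ^ γ + 1)⁻¹
      = ∫ v in Ioi (0 : ℝ), ∫ s in Ioi (0 : ℝ), Real.exp (-(v ^ γ + 1) * s) :=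
        (setIntegral_congr_fun measurableSet_Ioi hexp).symm
    _ = ∫ s in Ioi (0 : ℝ), ∫ v in Ioi (0 : ℝ), Real.exp (-(v ^ γ + 1) * s) :=
        integral_integral_swap hint
    _ = ∫ s in Ioi (0 : ℝ), Real.Gamma (1 / γ + 1) * (Real.exp (-s) * s ^ ((1 - 1 / γ) - 1)) := by
        refine setIntegral_congr_fun measurableSet_Ioi fun s hs => ?_
        have hsplit : ∀ v : ℝ, Real.exp (-(v ^ γ + 1) * s)
            = Real.exp (-s) * Real.exp (-s * v ^ γ) := by
          intro v
          rw [← Real.exp_add]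
          ring_nf
        simp only [hsplit]
        rw [integral_const_mul, integral_exp_neg_mul_rpow hγ0 hs]
        ring_nf
    _ = Real.Gamma (1 / γ + 1) * Real.Gamma (1 - 1 / γ) := by
        rw [integral_const_mul, Real.Gamma_eq_integral (sub_pos.2 ((div_lt_one hγ0).2 hγ))]
    _ = (Real.pi / γ) / Real.sin (Real.pi / γ) := by
        rw [Real.Gamma_add_one (by positivity), mul_assoc, Real.Gamma_mul_Gamma_one_sub]
        ring_nf

/-- Rescaling `u = l ^ (1 / γ) * v` reduces the tail integral to the case `l = 1`. -/
lemma integral_Ioi_inv_rpow_add_scale {γ l y : ℝ} (hγ : 1 < γ) (hl : 0 < l) (hy : 0 ≤ y) :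
    ∫ u in Ioi (l ^ (1 / γ) * y), (u ^ γ + l)⁻¹
      = (l ^ ((γ - 1) / γ))⁻¹ * ∫ v in Ioi y, (v ^ γ + 1)⁻¹ := by
  have hγ0 : 0 < γ := by linarith
  have hb : 0 < l ^ (1 / γ) := Real.rpow_pos_of_pos hl _
  have hbγ : (l ^ (1 / γ)) ^ γ = l := by
    rw [← Real.rpow_mul hl.le, one_div_mul_cancel hγ0.ne', Real.rpow_one]
  have hexp : l ^ ((γ - 1) / γ) = l / l ^ (1 / γ) := by
    rw [sub_div, div_self hγ0.ne', Real.rpow_sub hl, Real.rpow_one]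
  rw [← integral_comp_mul_left_Ioi' (fun u => (u ^ γ + l)⁻¹) y hb, smul_eq_mul, hexp, inv_div,
    div_mul_eq_mul_div, mul_div_assoc, ← integral_div]
  congr 1
  refine setIntegral_congr_fun measurableSet_Ioi fun v hv => ?_
  have hv0 : 0 ≤ v := hy.trans (le_of_lt hv)
  have hvp : 0 ≤ v ^ γ := Real.rpow_nonneg hv0 γ
  rw [Real.mul_rpow hb.le hv0, hbγ, div_eq_mul_inv, ← mul_inv]
  congr 1
  ring

/-- The inverse of `y ↦ ∫_y^∞ (v ^ γ + 1)⁻¹`; it is differentiable up to the value taken at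
`y = 0` because the integrand extends evenly to `ℝ`. -/
lemma exists_inverse_integral_Ioi {γ K : ℝ} (hγ : 1 < γ)
    (hK : ∫ v in Ioi (0 : ℝ), (v ^ γ + 1)⁻¹ = K) :
    ∃ g : ℝ → ℝ, g K = 0 ∧ ∀ s ∈ Ioc 0 K, 0 ≤ g s ∧ ∫ v in Ioi (g s), (v ^ γ + 1)⁻¹ = s ∧
      HasDerivAt g (-(g s ^ γ + 1)) s := by
  have hγ0 : 0 < γ := by linarith
  have hpos : ∀ v : ℝ, 0 < |v| ^ γ + 1 := fun v => by positivity
  have hcont : Continuous fun v : ℝ => (|v| ^ γ + 1)⁻¹ :=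
    (((Real.continuous_rpow_const hγ0.le).comp continuous_abs).add continuous_const).inv₀
      fun v => (hpos v).ne'
  set G : ℝ → ℝ := fun y => K - ∫ v in (0 : ℝ)..y, (|v| ^ γ + 1)⁻¹ with hG
  have hG0 : G 0 = K := by simp [hG]
  have hGderiv : ∀ y, HasStrictDerivAt G (-(|y| ^ γ + 1)⁻¹) y := fun y =>
    (hcont.integral_hasStrictDerivAt 0 y).const_sub K
  have hGanti : StrictAnti G := strictAnti_of_hasDerivAt_neg (fun y => (hGderiv y).hasDerivAt)
    fun y => by have := hpos y; simpa using this
  have hcongr : ∀ y, 0 ≤ y →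
      ∫ v in (0 : ℝ)..y, (v ^ γ + 1)⁻¹ = ∫ v in (0 : ℝ)..y, (|v| ^ γ + 1)⁻¹ := by
    intro y hy
    refine intervalIntegral.integral_congr fun v hv => ?_
    rw [uIcc_of_le hy] at hv
    simp only [abs_of_nonneg hv.1]
  have hGtail : ∀ y, 0 ≤ y → ∫ v in Ioi y, (v ^ γ + 1)⁻¹ = G y := by
    intro y hy
    have h := intervalIntegral.integral_Ioi_sub_Ioi
      (integrableOn_Ioi_inv_rpow_add hγ le_rfl zero_le_one (Or.inr one_pos)) hy
    simp only [hG, ← hcongr y hy]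
    linarith
  have hGlim : Tendsto G atTop (𝓝 0) := by
    have hi : IntegrableOn (fun v : ℝ => (v ^ γ + 1)⁻¹) (Ioi 0) :=
      integrableOn_Ioi_inv_rpow_add hγ le_rfl zero_le_one (Or.inr one_pos)
    have h := (intervalIntegral_tendsto_integral_Ioi 0 hi tendsto_id).const_sub K
    rw [hK, sub_self] at h
    refine h.congr' ((eventually_ge_atTop 0).mono fun y hy => ?_)
    simp only [hG, id, hcongr y hy]
  have hinv : ∀ y, Function.invFun G (G y) = y := Function.leftInverse_invFun hGanti.injective
  refine ⟨Function.invFun G, by rw [← hG0, hinv], fun s hs => ?_⟩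
  obtain ⟨y, hy, rfl⟩ : ∃ y, 0 ≤ y ∧ G y = s := by
    obtain ⟨b, hb0, hb⟩ : ∃ b, 0 ≤ b ∧ G b < s :=
      ((eventually_ge_atTop 0).and (hGlim.eventually (gt_mem_nhds hs.1))).exists
    have hGc : ContinuousOn G (Icc 0 b) := fun y _ =>
      (hGderiv y).hasDerivAt.continuousAt.continuousWithinAt
    obtain ⟨y, hy, hys⟩ := intermediate_value_Icc' hb0 hGc ⟨hb.le, by rw [hG0]; exact hs.2⟩
    exact ⟨y, hy.1, hys⟩
  rw [hinv]
  refine ⟨hy, hGtail y hy, ?_⟩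
  have h := ((hGderiv y).to_local_left_inverse (neg_ne_zero.2 (inv_ne_zero (hpos y).ne'))
    (Eventually.of_forall hinv)).hasDerivAt
  simpa only [inv_neg, inv_inv, abs_of_nonneg hy] using h

/-- A lower bound for `x` when the tail integral of `(u ^ γ + l)⁻¹` beyond `x` equals one. -/
lemma le_of_integral_Ioi_inv_rpow_add_eq_one {γ x l : ℝ} (hγ : 1 < γ) (hx : 0 < x) (hl : 0 ≤ l)
    (h : ∫ u in Ioi x, (u ^ γ + l)⁻¹ = 1) : x ≤ (γ - 1) * (x ^ γ + l) := by
  have hxp : 0 < x ^ γ := Real.rpow_pos_of_pos hx γ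
  have hle : ∫ u in Ioi x, (x ^ γ / (x ^ γ + l)) * u ^ (-γ) ≤ ∫ u in Ioi x, (u ^ γ + l)⁻¹ := by
    refine setIntegral_mono_on ((integrableOn_Ioi_rpow_of_lt (by linarith) hx).const_mul _)
      (integrableOn_Ioi_inv_rpow_add hγ hx.le hl (Or.inl hx)) measurableSet_Ioi fun u hu => ?_
    have hu0 : 0 < u := hx.trans hu
    have hup : 0 < u ^ γ := Real.rpow_pos_of_pos hu0 γ
    have hxu : x ^ γ ≤ u ^ γ := Real.rpow_le_rpow hx.le (le_of_lt hu) (by linarith)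
    rw [Real.rpow_neg hu0.le, ← div_eq_mul_inv, div_div, inv_eq_one_div,
      div_le_div_iff₀ (by positivity) (by positivity)]
    nlinarith
  rw [h, integral_const_mul, integral_Ioi_rpow_of_lt (by linarith) hx, Real.rpow_add hx,
    Real.rpow_neg hx.le, Real.rpow_one] at hle
  have hγ' : 0 < γ - 1 := by linarith
  have hval : x ^ γ / (x ^ γ + l) * (-((x ^ γ)⁻¹ * x) / (-γ + 1))
      = x / ((γ - 1) * (x ^ γ + l)) := by
    rw [show -γ + 1 = -(γ - 1) by ring, neg_div_neg_eq]
    field_simp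
  rw [hval, div_le_one (by positivity)] at hle
  exact hle

lemma integral_Ioi_inv_rpow_critical {γ : ℝ} (hγ : 1 < γ) :
    ∫ u in Ioi ((γ - 1) ^ (-(1 / (γ - 1)))), (u ^ γ + 0)⁻¹ = 1 := by
  have hγ' : 0 < γ - 1 := by linarith
  have hx : 0 < (γ - 1) ^ (-(1 / (γ - 1))) := Real.rpow_pos_of_pos hγ' _
  calc ∫ u in Ioi ((γ - 1) ^ (-(1 / (γ - 1)))), (u ^ γ + 0)⁻¹
      = ∫ u in Ioi ((γ - 1) ^ (-(1 / (γ - 1)))), u ^ (-γ) :=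
        setIntegral_congr_fun measurableSet_Ioi fun u hu => by
          simp only [add_zero, Real.rpow_neg (hx.trans hu).le]
    _ = 1 := by
        rw [integral_Ioi_rpow_of_lt (by linarith) hx, ← Real.rpow_mul hγ'.le,
          show -(1 / (γ - 1)) * (-γ + 1) = 1 by field_simp; ring, Real.rpow_one,
          show -γ + 1 = -(γ - 1) by ring, neg_div_neg_eq, div_self hγ'.ne']

/-- Continuity at zero of the solution `r` of `∫_{r l}^∞ (u ^ γ + l)⁻¹ = 1`. -/
lemma continuousWithinAt_zero_of_integral_eq_one {γ L : ℝ} (hγ : 1 < γ) (hL : 0 < L) {r : ℝ → ℝ}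
    (hanti : StrictAntiOn r (Icc 0 L)) (hnonneg : ∀ l ∈ Icc (0 : ℝ) L, 0 ≤ r l)
    (hint : ∀ l ∈ Icc (0 : ℝ) L, ∫ u in Ioi (r l), (u ^ γ + l)⁻¹ = 1)
    (hr0 : r 0 = (γ - 1) ^ (-(1 / (γ - 1)))) : ContinuousWithinAt r (Icc 0 L) 0 := by
  have hγ' : 0 < γ - 1 := by linarith
  have hmid : L / 2 ∈ Icc 0 L := ⟨by linarith, by linarith⟩
  set c := r (L / 2)
  have hc : 0 < c := (hnonneg L ⟨hL.le, le_rfl⟩).trans_lt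
    (hanti hmid ⟨hL.le, le_rfl⟩ (by linarith))
  have hcγ : 0 < c ^ γ := Real.rpow_pos_of_pos hc γ
  have hlim : Tendsto (fun l : ℝ => ((γ - 1) * (1 + l / c ^ γ)) ^ (-(1 / (γ - 1))))
      (𝓝[Icc 0 L] 0) (𝓝 (r 0)) := by
    have h : ContinuousAt (fun l : ℝ => ((γ - 1) * (1 + l / c ^ γ)) ^ (-(1 / (γ - 1)))) 0 :=
      ContinuousAt.rpow_const (by fun_prop) (Or.inl (by simpa using hγ'.ne'))
    have h' := h.tendsto
    simp only [zero_div, add_zero, mul_one] at h'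
    rw [hr0]
    exact h'.mono_left nhdsWithin_le_nhds
  refine tendsto_of_tendsto_of_tendsto_of_le_of_le' hlim tendsto_const_nhds ?_ ?_
  · have hsmall : ∀ᶠ l in 𝓝[Icc 0 L] (0 : ℝ), l < L / 2 :=
      nhdsWithin_le_nhds (gt_mem_nhds (by linarith))
    filter_upwards [hsmall, self_mem_nhdsWithin] with l hl hlI
    have hcr : c ≤ r l := hanti.antitoneOn hlI hmid hl.le
    have hrpos : 0 < r l := hc.trans_le hcr
    have hrγ : 0 < r l ^ γ := Real.rpow_pos_of_pos hrpos γ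
    have hkey := le_of_integral_Ioi_inv_rpow_add_eq_one hγ hrpos hlI.1 (hint l hlI)
    have hpow : r l ^ (1 - γ) ≤ (γ - 1) * (1 + l / c ^ γ) := by
      rw [Real.rpow_sub hrpos, Real.rpow_one, div_le_iff₀ hrγ]
      have hcrγ : c ^ γ ≤ r l ^ γ := Real.rpow_le_rpow hc.le hcr (by linarith)
      have hl' : l ≤ l / c ^ γ * r l ^ γ := by
        rw [div_mul_eq_mul_div, le_div_iff₀ hcγ]
        exact mul_le_mul_of_nonneg_left hcrγ hlI.1
      nlinarith
    calc ((γ - 1) * (1 + l / c ^ γ)) ^ (-(1 / (γ - 1)))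
        ≤ (r l ^ (1 - γ)) ^ (-(1 / (γ - 1))) :=
          Real.rpow_le_rpow_of_nonpos (Real.rpow_pos_of_pos hrpos _) hpow
            (neg_nonpos.2 (by positivity))
      _ = r l := by
          rw [← Real.rpow_mul hrpos.le, show (1 - γ) * -(1 / (γ - 1)) = 1 by field_simp; ring,
            Real.rpow_one]
  · filter_upwards [self_mem_nhdsWithin] with l hl
    exact hanti.antitoneOn ⟨le_rfl, hL.le⟩ hl hl.1

/-- Let `γ ∈ (1,2)` and `λ_cr := ((π/γ)/sin(π/γ))^{γ/(γ−1)}`.  There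
is a strictly decreasing continuous `r : [0,λ_cr] → [0,(γ−1)^{−1/(γ−1)}]` with
`∫_{r(λ)}^∞ du/(u^γ + λ) = 1` on `[0,λ_cr]`, `r(0) = (γ−1)^{−1/(γ−1)}`, `r(λ_cr) = 0`,
and `r` is differentiable on `(0,λ_cr)` with
`−r'(λ) = ((γ−1)/γ) λ⁻¹ r(λ)^γ − (1/γ) λ⁻¹ r(λ) + (γ−1)/γ`. -/
theorem stmt16 (γ : ℝ) (hγ1 : 1 < γ) (hγ2 : γ < 2)
    (lcr : ℝ) (hlcr : lcr = ((Real.pi / γ) / Real.sin (Real.pi / γ)) ^ (γ / (γ - 1))) :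
    ∃ r : ℝ → ℝ,
      StrictAntiOn r (Set.Icc 0 lcr) ∧
      ContinuousOn r (Set.Icc 0 lcr) ∧
      (∀ lam ∈ Set.Icc (0:ℝ) lcr,
        r lam ∈ Set.Icc (0:ℝ) ((γ - 1) ^ (-(1 / (γ - 1))))) ∧
      (∀ lam ∈ Set.Icc (0:ℝ) lcr,
        (∫ u in Set.Ioi (r lam), (u ^ γ + lam)⁻¹) = 1) ∧
      r 0 = (γ - 1) ^ (-(1 / (γ - 1))) ∧ r lcr = 0 ∧
      ∀ lam ∈ Set.Ioo (0:ℝ) lcr,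
        HasDerivAt r
          (-(((γ - 1)/γ) * lam⁻¹ * r lam ^ γ - (1/γ) * lam⁻¹ * r lam + (γ - 1)/γ))
          lam := by
  have hγ0 : 0 < γ := by linarith
  have hγ' : 0 < γ - 1 := by linarith
  set K := (Real.pi / γ) / Real.sin (Real.pi / γ)
  have hKpos : 0 < K := by
    have hsin : 0 < Real.sin (Real.pi / γ) :=
      Real.sin_pos_of_pos_of_lt_pi (by positivity) (div_lt_self Real.pi_pos hγ1)
    positivity
  have hlpos : 0 < lcr := hlcr ▸ Real.rpow_pos_of_pos hKpos _
  have hlK : lcr ^ ((γ - 1) / γ) = K := by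
    rw [hlcr, ← Real.rpow_mul hKpos.le, show γ / (γ - 1) * ((γ - 1) / γ) = 1 by field_simp,
      Real.rpow_one]
  obtain ⟨g, hgK, hg⟩ := exists_inverse_integral_Ioi hγ1 (integral_Ioi_inv_rpow_add_one hγ1)
  have hmem : ∀ l ∈ Ioc 0 lcr, l ^ ((γ - 1) / γ) ∈ Ioc 0 K := fun l hl =>
    ⟨Real.rpow_pos_of_pos hl.1 _, hlK ▸ Real.rpow_le_rpow hl.1.le hl.2 (by positivity)⟩
  set r : ℝ → ℝ := fun l =>
    if l = 0 then (γ - 1) ^ (-(1 / (γ - 1))) else l ^ (1 / γ) * g (l ^ ((γ - 1) / γ)) with hr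
  have hr0 : r 0 = (γ - 1) ^ (-(1 / (γ - 1))) := if_pos rfl
  have hrpos : ∀ l, 0 < l → r l = l ^ (1 / γ) * g (l ^ ((γ - 1) / γ)) := fun l hl => if_neg hl.ne'
  have hr0pos : 0 < r 0 := hr0 ▸ Real.rpow_pos_of_pos hγ' _
  have hnonneg : ∀ l ∈ Icc 0 lcr, 0 ≤ r l := by
    intro l hl
    rcases hl.1.eq_or_lt with rfl | hl0
    · exact hr0pos.le
    · rw [hrpos l hl0]
      exact mul_nonneg (Real.rpow_nonneg hl.1 _) (hg _ (hmem l ⟨hl0, hl.2⟩)).1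
  have hint : ∀ l ∈ Icc 0 lcr, ∫ u in Ioi (r l), (u ^ γ + l)⁻¹ = 1 := by
    intro l hl
    rcases hl.1.eq_or_lt with rfl | hl0
    · rw [hr0]
      exact integral_Ioi_inv_rpow_critical hγ1
    · obtain ⟨h0, h1, -⟩ := hg _ (hmem l ⟨hl0, hl.2⟩)
      rw [hrpos l hl0, integral_Ioi_inv_rpow_add_scale hγ1 hl0 h0, h1,
        inv_mul_cancel₀ (Real.rpow_pos_of_pos hl0 _).ne']
  have hanti : StrictAntiOn r (Icc 0 lcr) := by
    intro a ha b hb hab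
    by_contra! hle
    refine absurd (integral_Ioi_inv_rpow_add_lt hγ1 (hnonneg a ha) hle ha.1 hab ?_) ?_
    · rcases ha.1.eq_or_lt with rfl | ha0
      · exact Or.inl hr0pos
      · exact Or.inr ha0
    · rw [hint a ha, hint b hb]
      exact lt_irrefl 1
  have hderiv : ∀ l ∈ Ioc 0 lcr, HasDerivAt r
      (-(((γ - 1)/γ) * l⁻¹ * r l ^ γ - (1/γ) * l⁻¹ * r l + (γ - 1)/γ)) l := by
    intro l hl
    have hl0 : 0 < l := hl.1
    obtain ⟨h0, -, hd⟩ := hg _ (hmem l hl)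
    have hp₁ := Real.hasDerivAt_rpow_const (p := 1 / γ) (Or.inl hl0.ne')
    have hp₂ := Real.hasDerivAt_rpow_const (p := (γ - 1) / γ) (Or.inl hl0.ne')
    have hprod := hp₁.mul (hd.comp l hp₂)
    have heq : r =ᶠ[𝓝 l] fun l => l ^ (1 / γ) * g (l ^ ((γ - 1) / γ)) :=
      (lt_mem_nhds hl0).mono hrpos
    refine (hprod.congr_of_eventuallyEq heq).congr_deriv ?_
    have hb : 0 < l ^ (1 / γ) := Real.rpow_pos_of_pos hl0 _
    have e₁ : l ^ (1 / γ - 1) = l ^ (1 / γ) / l := by rw [Real.rpow_sub hl0, Real.rpow_one]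
    have e₂ : l ^ ((γ - 1) / γ - 1) = (l ^ (1 / γ))⁻¹ := by
      rw [← Real.rpow_neg hl0.le]
      congr 1
      field_simp
      ring
    have e₃ : (l ^ (1 / γ)) ^ γ = l := by
      rw [← Real.rpow_mul hl0.le, one_div_mul_cancel hγ0.ne', Real.rpow_one]
    rw [hrpos l hl0, Real.mul_rpow hb.le h0, e₁, e₂, e₃]
    simp only [Function.comp_apply]
    field_simp
    ring
  refine ⟨r, hanti, ?_, fun l hl => ⟨hnonneg l hl, ?_⟩, hint, hr0, ?_,
    fun l hl => hderiv l ⟨hl.1, hl.2.le⟩⟩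
  · intro l hl
    rcases hl.1.eq_or_lt with rfl | hl0
    · exact continuousWithinAt_zero_of_integral_eq_one hγ1 hlpos hanti hnonneg hint hr0
    · exact (hderiv l ⟨hl0, hl.2⟩).continuousAt.continuousWithinAt
  · rw [← hr0]
    exact hanti.antitoneOn ⟨le_rfl, hlpos.le⟩ hl hl.1
  · rw [hrpos lcr hlpos, hlK, hgK, mul_zero]
end

section
/- Define θ(x) := (γ−1) x^{−1} s_γ(x) − ((γ−1)/γ) x^{−1−1/γ} ∫_0^x y^{1/γ−1} s_γ(y) dy for x > 0. Assume there exists a real sequence (S_n*)_{n≥0} such that for every integer N ≥ 1, as x → 0+: s_γ(x) = Σ_{0≤n<N} S_n* · x^{n(γ−1) − (γ+1)/2} e^{−b(x)} + O( x^{N(γ−1) − (γ+1)/2} e^{−b(x)} ). Define (V_n*)_{n≥0} by V₀* := (γ−1) S₀* and, for every n ≥ 0, (γ−1)^{γ−1} V_{n+1}* := (γ−1)^γ S_{n+1}* + (γ−1)( n − 1/2 − 1/(γ−1) ) S_n* − ( n − 1/2 − 1/γ ) V_n*. Then for every integer N ≥ 1, as x → 0+: θ(x) = Σ_{0≤n<N}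 V_n* · x^{n(γ−1) − (γ+3)/2} e^{−b(x)} + O( x^{N(γ−1) − (γ+3)/2} e^{−b(x)} ). -/
open MeasureTheory Asymptotics Filter Topology

/-- The derivative of `x ^ p * exp (-k x ^ (-c))`. -/
lemma hasDerivAt_rpow_mul_exp_neg_rpow (k c p : ℝ) {x : ℝ} (hx : 0 < x) :
    HasDerivAt (fun x : ℝ => x ^ p * Real.exp (-(k * x ^ (-c))))
      ((k * c * x ^ (p - c - 1) + p * x ^ (p - 1)) * Real.exp (-(k * x ^ (-c)))) x := by
  have h1 : HasDerivAt (fun x : ℝ => x ^ p) (p * x ^ (p - 1)) x :=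
    Real.hasDerivAt_rpow_const (Or.inl hx.ne')
  have h2 : HasDerivAt (fun x : ℝ => x ^ (-c)) (-c * x ^ (-c - 1)) x :=
    Real.hasDerivAt_rpow_const (Or.inl hx.ne')
  refine (h1.mul (h2.const_mul k).neg.exp).congr_deriv ?_
  have h3 : x ^ (p - c - 1) = x ^ p * x ^ (-c - 1) := by
    rw [← Real.rpow_add hx]; ring_nf
  simp only [Pi.neg_apply]
  rw [h3]; ring

/-- `x ^ p * exp (-k x ^ (-c))` vanishes at `0+`. -/
lemma tendsto_rpow_mul_exp_neg_rpow {k c : ℝ} (hk : 0 < k) (hc : 0 < c) (p : ℝ) :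
    Tendsto (fun x : ℝ => x ^ p * Real.exp (-(k * x ^ (-c)))) (𝓝[>] 0) (𝓝 0) := by
  have h := (tendsto_rpow_mul_exp_neg_mul_atTop_nhds_zero (-(p / c)) k hk).comp
    (tendsto_rpow_neg_nhdsGT_zero (y := -c) (by linarith))
  refine h.congr' ?_
  filter_upwards [self_mem_nhdsWithin] with x hx
  have hx : 0 < x := hx
  simp only [Function.comp]
  rw [← Real.rpow_mul hx.le, show -c * -(p / c) = p by field_simp]
  ring_nf

/-- If `|D'| ≤ G'` near `0+` and `D`, `G` vanish at `0+`, then `D ≤ G` near `0+`. -/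
lemma eventually_le_of_deriv_le {D D' G G' : ℝ → ℝ}
    (hD : ∀ x, 0 < x → HasDerivAt D (D' x) x) (hG : ∀ x, 0 < x → HasDerivAt G (G' x) x)
    (hD0 : Tendsto D (𝓝[>] 0) (𝓝 0)) (hG0 : Tendsto G (𝓝[>] 0) (𝓝 0))
    (h : ∀ᶠ x in 𝓝[>] (0:ℝ), D' x ≤ G' x) :
    ∀ᶠ x in 𝓝[>] (0:ℝ), D x ≤ G x := by
  obtain ⟨δ, hδ, hsub⟩ := mem_nhdsGT_iff_exists_Ioo_subset.1 h
  have hderiv : ∀ x, 0 < x → HasDerivAt (fun x => G x - D x) (G' x - D' x) x :=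
    fun x hx => (hG x hx).sub (hD x hx)
  have hmono : MonotoneOn (fun x => G x - D x) (Set.Ioo 0 δ) := by
    refine monotoneOn_of_deriv_nonneg (convex_Ioo 0 δ)
      (fun x hx => (hderiv x hx.1).continuousAt.continuousWithinAt) ?_ ?_
    · rw [interior_Ioo]
      exact fun x hx => (hderiv x hx.1).differentiableAt.differentiableWithinAt
    · rw [interior_Ioo]
      intro x hx
      rw [(hderiv x hx.1).deriv]
      exact sub_nonneg.2 (hsub hx)
  have hlim : Tendsto (fun x => G x - D x) (𝓝[>] 0) (𝓝 0) := by simpa using hG0.sub hD0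
  filter_upwards [Ioo_mem_nhdsGT hδ] with x hx
  refine sub_nonneg.1 (le_of_tendsto hlim ?_)
  filter_upwards [Ioo_mem_nhdsGT hx.1] with y hy
  exact hmono ⟨hy.1, hy.2.trans hx.2⟩ hx hy.2.le

/-- Integration of the estimate `D' = O(x ^ a * exp (-k x ^ (-c)))` at `0+`. -/
lemma isBigO_rpow_mul_exp_neg_rpow_of_deriv {k c : ℝ} (hk : 0 < k) (hc : 0 < c) (a : ℝ)
    {D D' : ℝ → ℝ} (hD : ∀ x, 0 < x → HasDerivAt D (D' x) x)
    (hD0 : Tendsto D (𝓝[>] 0) (𝓝 0))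
    (hO : D' =O[𝓝[>] (0:ℝ)] fun x => x ^ a * Real.exp (-(k * x ^ (-c)))) :
    D =O[𝓝[>] (0:ℝ)] fun x => x ^ (a + c + 1) * Real.exp (-(k * x ^ (-c))) := by
  obtain ⟨C, hC, hbound⟩ := hO.exists_pos
  set K : ℝ := 2 * C / (k * c)
  have hG : ∀ x : ℝ, 0 < x →
      HasDerivAt (fun x : ℝ => K * (x ^ (a + c + 1) * Real.exp (-(k * x ^ (-c)))))
        (K * ((k * c * x ^ (a + c + 1 - c - 1) + (a + c + 1) * x ^ (a + c + 1 - 1)) *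
          Real.exp (-(k * x ^ (-c))))) x :=
    fun x hx => (hasDerivAt_rpow_mul_exp_neg_rpow k c (a + c + 1) hx).const_mul K
  have hG0 := (tendsto_rpow_mul_exp_neg_rpow hk hc (a + c + 1)).const_mul K
  rw [mul_zero] at hG0
  have hsmall : ∀ᶠ x : ℝ in 𝓝[>] 0, -(k * c / 2) < (a + c + 1) * x ^ c := by
    have h0 : Tendsto (fun x : ℝ => (a + c + 1) * x ^ c) (𝓝[>] 0) (𝓝 0) := by
      have h1 : ContinuousAt (fun x : ℝ => (a + c + 1) * x ^ c) 0 :=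
        continuousAt_const.mul (Real.continuousAt_rpow_const 0 c (Or.inr hc.le))
      have h2 := h1.tendsto
      simp only [Real.zero_rpow hc.ne', mul_zero] at h2
      exact h2.mono_left nhdsWithin_le_nhds
    exact h0.eventually (lt_mem_nhds (by linarith [mul_pos hk hc]))
  have hle : ∀ᶠ x : ℝ in 𝓝[>] 0, |D' x| ≤
      K * ((k * c * x ^ (a + c + 1 - c - 1) + (a + c + 1) * x ^ (a + c + 1 - 1)) *
          Real.exp (-(k * x ^ (-c)))) := by
    filter_upwards [hbound.bound, hsmall, self_mem_nhdsWithin] with x h1 h2 h3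
    have hx : 0 < x := h3
    have hpos : 0 < x ^ a * Real.exp (-(k * x ^ (-c))) :=
      mul_pos (Real.rpow_pos_of_pos hx a) (Real.exp_pos _)
    rw [Real.norm_eq_abs, Real.norm_eq_abs, abs_of_pos hpos] at h1
    refine h1.trans ?_
    rw [show a + c + 1 - c - 1 = a by ring, show a + c + 1 - 1 = a + c by ring,
      Real.rpow_add hx]
    have hK : 0 < K := by positivity
    calc C * (x ^ a * Real.exp (-(k * x ^ (-c))))
        = K * (k * c / 2) * (x ^ a * Real.exp (-(k * x ^ (-c)))) := by
          simp only [K]; field_simp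
      _ ≤ K * (k * c + (a + c + 1) * x ^ c) * (x ^ a * Real.exp (-(k * x ^ (-c)))) := by
          gcongr; linarith
      _ = _ := by ring
  have hneg0 : Tendsto (-D) (𝓝[>] 0) (𝓝 0) := by
    have h := hD0.neg
    rwa [neg_zero] at h
  have hup := eventually_le_of_deriv_le hD hG hD0 hG0 (hle.mono fun x h => (le_abs_self _).trans h)
  have hlo := eventually_le_of_deriv_le (fun x hx => (hD x hx).neg) hG hneg0
    hG0 (hle.mono fun x h => (neg_le_abs _).trans h)
  refine IsBigO.of_bound K ?_
  filter_upwards [hup, hlo, self_mem_nhdsWithin] with x h1 h2 h3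
  have hpos : 0 < x ^ (a + c + 1) * Real.exp (-(k * x ^ (-c))) :=
    mul_pos (Real.rpow_pos_of_pos h3 _) (Real.exp_pos _)
  rw [Real.norm_eq_abs, Real.norm_eq_abs, abs_of_pos hpos]
  exact abs_le'.2 ⟨h1, h2⟩

lemma intervalIntegrable_rpow_mul {s : ℝ → ℝ} (hs : ContinuousOn s (Set.Ici 0)) {q : ℝ} (hq : -1 < q)
    {x : ℝ} (hx : 0 ≤ x) : IntervalIntegrable (fun y => y ^ q * s y) volume 0 x := by
  refine (intervalIntegral.intervalIntegrable_rpow' hq).mul_continuousOn (hs.mono ?_)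
  rw [Set.uIcc_of_le hx]
  exact Set.Icc_subset_Ici_self

lemma hasDerivAt_integral_rpow_mul {s : ℝ → ℝ} (hs : ContinuousOn s (Set.Ici 0)) {q : ℝ}
    (hq : -1 < q) {x : ℝ} (hx : 0 < x) :
    HasDerivAt (fun x => ∫ y in (0:ℝ)..x, y ^ q * s y) (x ^ q * s x) x := by
  have hcont : ContinuousOn (fun y => y ^ q * s y) (Set.Ioi 0) :=
    ContinuousOn.mul (fun y hy =>
      (Real.continuousAt_rpow_const y q (Or.inl (ne_of_gt hy))).continuousWithinAt)
      (hs.mono Set.Ioi_subset_Ici_self)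
  exact intervalIntegral.integral_hasDerivAt_right (intervalIntegrable_rpow_mul hs hq hx.le)
    (hcont.stronglyMeasurableAtFilter isOpen_Ioi x hx) (hcont.continuousAt (Ioi_mem_nhds hx))

lemma tendsto_integral_rpow_mul {s : ℝ → ℝ} (hs : ContinuousOn s (Set.Ici 0)) {q : ℝ}
    (hq : -1 < q) :
    Tendsto (fun x => ∫ y in (0:ℝ)..x, y ^ q * s y) (𝓝[>] 0) (𝓝 0) := by
  have hInt := (intervalIntegrable_iff' enorm_ne_top).1
    (intervalIntegrable_rpow_mul hs hq (zero_le_one' ℝ))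
  have h := intervalIntegral.continuousOn_primitive_interval hInt 0 Set.left_mem_uIcc
  have h' := h.tendsto
  rw [intervalIntegral.integral_same] at h'
  refine h'.mono_left ?_
  rw [Set.uIcc_of_le zero_le_one, nhdsWithin_Icc_eq_nhdsGE zero_lt_one]
  exact nhdsWithin_mono _ Set.Ioi_subset_Ici_self

/-- Fix `γ ∈ (1,2]`, let `s_γ` be the continuous density of the
spectrally positive stable law of index `(γ−1)/γ`, set `b(x) := ((γ−1)/x)^{γ−1}`, and
define `θ(x) := (γ−1) x⁻¹ s_γ(x) − ((γ−1)/γ) x^{−1−1/γ} ∫_0^x y^{1/γ−1} s_γ(y) dy`.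
Assuming the asymptotic expansion of `s_γ` at `0+` with coefficients `(S_n*)`, and with
`(V_n*)` defined by the stated recursion, for every `N ≥ 1`, as `x → 0+`,
`θ(x) = Σ_{n<N} V_n* x^{n(γ−1) − (γ+3)/2} e^{−b(x)} + O(x^{N(γ−1) − (γ+3)/2} e^{−b(x)})`. -/
theorem stmt18 (γ : ℝ) (hγ1 : 1 < γ) (hγ2 : γ ≤ 2)
    (s : ℝ → ℝ) (hs_cont : ContinuousOn s (Set.Ici 0))
    (hs_nonneg : ∀ x ∈ Set.Ici (0:ℝ), 0 ≤ s x)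
    (hs_lap : ∀ lam : ℝ, 0 ≤ lam →
      (∫ x in Set.Ioi (0:ℝ), Real.exp (-(lam * x)) * s x)
        = Real.exp (-(γ * lam ^ ((γ - 1) / γ))))
    (θ : ℝ → ℝ)
    (hθ : ∀ x ∈ Set.Ioi (0:ℝ),
      θ x = (γ - 1) * x⁻¹ * s x
        - ((γ - 1) / γ) * x ^ (-1 - 1/γ) * ∫ y in Set.Ioc (0:ℝ) x, y ^ (1/γ - 1) * s y)
    (S V : ℕ → ℝ)
    (hS : ∀ N : ℕ, 1 ≤ N →
      (fun x => s x - ∑ n ∈ Finset.range N,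
          S n * x ^ ((n:ℝ) * (γ - 1) - (γ + 1)/2) * Real.exp (-(((γ - 1)/x) ^ (γ - 1))))
        =O[𝓝[>] (0:ℝ)]
      fun x => x ^ ((N:ℝ) * (γ - 1) - (γ + 1)/2) * Real.exp (-(((γ - 1)/x) ^ (γ - 1))))
    (hV0 : V 0 = (γ - 1) * S 0)
    (hVrec : ∀ n : ℕ,
      (γ - 1) ^ (γ - 1) * V (n + 1)
        = (γ - 1) ^ γ * S (n + 1)
          + (γ - 1) * ((n:ℝ) - 1/2 - 1/(γ - 1)) * S n
          - ((n:ℝ) - 1/2 - 1/γ) * V n) :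
    ∀ N : ℕ, 1 ≤ N →
      (fun x => θ x - ∑ n ∈ Finset.range N,
          V n * x ^ ((n:ℝ) * (γ - 1) - (γ + 3)/2) * Real.exp (-(((γ - 1)/x) ^ (γ - 1))))
        =O[𝓝[>] (0:ℝ)]
      fun x => x ^ ((N:ℝ) * (γ - 1) - (γ + 3)/2) * Real.exp (-(((γ - 1)/x) ^ (γ - 1))) := by
  intro N hN
  obtain ⟨c, rfl⟩ : ∃ c, γ = c + 1 := ⟨γ - 1, by ring⟩
  have hc : 0 < c := by linarith
  simp only [add_sub_cancel_right] at *
  have hk : 0 < c ^ c := Real.rpow_pos_of_pos hc c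
  have hkc : c ^ (c + 1) = c ^ c * c := by rw [Real.rpow_add hc, Real.rpow_one]
  have hq : -1 < 1 / (c + 1) - 1 := by
    have : 0 < 1 / (c + 1) := by positivity
    linarith
  have hE : ∀ x : ℝ, 0 < x → (c / x) ^ c = c ^ c * x ^ (-c) := fun x hx => by
    rw [Real.div_rpow hc.le hx.le, Real.rpow_neg hx.le, div_eq_mul_inv]
  set E : ℝ → ℝ := fun x => Real.exp (-(c ^ c * x ^ (-c))) with hEdef
  have hexp : ∀ x : ℝ, 0 < x → Real.exp (-(c / x) ^ c) = E x := fun x hx => by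
    rw [hE x hx]
  set I : ℝ → ℝ := fun x => ∫ y in (0:ℝ)..x, y ^ (1 / (c + 1) - 1) * s y
  -- coefficients and exponents of the expansion of `I`
  set U : ℕ → ℝ := fun n => ((c + 1) / c) * (c * S n - V n) with hU
  set r : ℕ → ℝ := fun n => c * ((n:ℝ) - 1 / 2 - 1 / (c + 1)) with hr
  have hrsucc : ∀ n : ℕ, r (n + 1) = r n + c := fun n => by
    simp only [hr]; push_cast; ring
  have hrs : ∀ n : ℕ, (n:ℝ) * c - (c + 1 + 1) / 2 + (1 / (c + 1) - 1) = r n - 1 := fun n => by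
    simp only [hr]; field_simp; ring
  have hrθ : ∀ n : ℕ, -1 - 1 / (c + 1) + r n = (n:ℝ) * c - (c + 1 + 3) / 2 := fun n => by
    simp only [hr]; field_simp; ring
  have hU0 : U 0 = 0 := by simp [hU, hV0]
  have hVU : ∀ n, V n = c * S n - c / (c + 1) * U n := fun n => by
    simp only [hU]; field_simp; ring
  have hUrec : ∀ n, c ^ c * c * U (n + 1) = S n - r n * U n := fun n => by
    have h := hVrec n
    rw [hkc] at h
    have h' : c ^ c * (c * S (n + 1) - V (n + 1)) =
        ((n:ℝ) - 1 / 2 - 1 / (c + 1)) * V n - c * ((n:ℝ) - 1 / 2 - 1 / c) * S n := by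
      linear_combination -h
    have h'' : c ^ c * c * U (n + 1) = (c + 1) * (c ^ c * (c * S (n + 1) - V (n + 1))) := by
      simp only [hU]; field_simp
    rw [h'', h']
    simp only [hU, hr]; field_simp; ring
  set R : ℝ → ℝ := fun x => s x - ∑ n ∈ Finset.range N,
    S n * x ^ ((n:ℝ) * c - (c + 1 + 1) / 2) * E x with hR
  have hRO : R =O[𝓝[>] (0:ℝ)] fun x => x ^ ((N:ℝ) * c - (c + 1 + 1) / 2) * E x := by
    refine (hS N hN).congr' ?_ ?_
    · filter_upwards [self_mem_nhdsWithin] with x hx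
      rw [hexp x hx]
    · filter_upwards [self_mem_nhdsWithin] with x hx
      rw [hexp x hx]
  set D : ℝ → ℝ := fun x => I x - ∑ n ∈ Finset.range N, U (n + 1) * (x ^ r (n + 1) * E x) with hD
  have hDderiv : ∀ x, 0 < x → HasDerivAt D
      (x ^ (1 / (c + 1) - 1) * R x - r N * U N * (x ^ (r N - 1) * E x)) x := by
    intro x hx
    have h1 := (hasDerivAt_integral_rpow_mul hs_cont hq hx).sub
      (HasDerivAt.fun_sum (u := Finset.range N) fun n _ =>
        (hasDerivAt_rpow_mul_exp_neg_rpow (c ^ c) c (r (n + 1)) hx).const_mul (U (n + 1)))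
    refine h1.congr_deriv ?_
    have htel := Finset.sum_range_sub (fun n => r n * U n * (x ^ (r n - 1) * E x)) N
    simp only [hU0, mul_zero, zero_mul, sub_zero] at htel
    rw [← htel, hR]
    simp only [mul_sub]
    rw [sub_sub, Finset.mul_sum, ← Finset.sum_add_distrib]
    congr 1
    refine Finset.sum_congr rfl fun n _ => ?_
    rw [show r (n + 1) - c - 1 = r n - 1 by rw [hrsucc]; ring]
    have hx1 : x ^ (r n - 1) = x ^ ((n:ℝ) * c - (c + 1 + 1) / 2) * x ^ (1 / (c + 1) - 1) := by
      rw [← hrs, Real.rpow_add hx]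
    change U (n + 1) * ((c ^ c * c * x ^ (r n - 1) + _) * E x) = _
    linear_combination (x ^ (r n - 1) * E x) * hUrec n + S n * E x * hx1
  have hD0 : Tendsto D (𝓝[>] 0) (𝓝 0) := by
    have h := (tendsto_integral_rpow_mul hs_cont hq).sub
      (tendsto_finsetSum (Finset.range N) fun n _ =>
        (tendsto_rpow_mul_exp_neg_rpow hk hc (r (n + 1))).const_mul (U (n + 1)))
    simpa only [mul_zero, Finset.sum_const_zero, sub_zero] using h
  have hDO : D =O[𝓝[>] (0:ℝ)] fun x => x ^ r (N + 1) * E x := by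
    have h : D =O[𝓝[>] (0:ℝ)] fun x => x ^ (r N - 1 + c + 1) * E x := by
      refine isBigO_rpow_mul_exp_neg_rpow_of_deriv hk hc (r N - 1) hDderiv hD0 ?_
      refine IsBigO.sub ?_ ((isBigO_refl _ _).const_mul_left _)
      refine ((isBigO_refl (fun x : ℝ => x ^ (1 / (c + 1) - 1)) _).mul hRO).congr'
        EventuallyEq.rfl ?_
      filter_upwards [self_mem_nhdsWithin] with x hx
      rw [← hrs, Real.rpow_add hx]
      ring
    rwa [show r N - 1 + c + 1 = r (N + 1) by rw [hrsucc]; ring] at h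
  have hθD : ∀ x, 0 < x → θ x - ∑ n ∈ Finset.range N,
      V n * x ^ ((n:ℝ) * c - (c + 1 + 3) / 2) * E x =
      c * (x⁻¹ * R x) - c / (c + 1) * (x ^ (-1 - 1 / (c + 1)) * D x)
        - c / (c + 1) * U N * (x ^ ((N:ℝ) * c - (c + 1 + 3) / 2) * E x) := by
    intro x hx
    have htel := Finset.sum_range_sub
      (fun n => U n * (x ^ ((n:ℝ) * c - (c + 1 + 3) / 2) * E x)) N
    simp only [hU0, zero_mul, sub_zero, Finset.sum_sub_distrib] at htel
    have hsumD : x ^ (-1 - 1 / (c + 1)) *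
          ∑ n ∈ Finset.range N, U (n + 1) * (x ^ r (n + 1) * E x) =
        ∑ n ∈ Finset.range N,
          U (n + 1) * (x ^ (((n + 1 : ℕ):ℝ) * c - (c + 1 + 3) / 2) * E x) := by
      rw [Finset.mul_sum]
      refine Finset.sum_congr rfl fun n _ => ?_
      rw [← hrθ, Real.rpow_add hx]
      ring
    have hsumV : ∑ n ∈ Finset.range N, V n * x ^ ((n:ℝ) * c - (c + 1 + 3) / 2) * E x =
        c * (x⁻¹ * ∑ n ∈ Finset.range N, S n * x ^ ((n:ℝ) * c - (c + 1 + 1) / 2) * E x)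
        - c / (c + 1) *
          ∑ n ∈ Finset.range N, U n * (x ^ ((n:ℝ) * c - (c + 1 + 3) / 2) * E x) := by
      simp only [Finset.mul_sum]
      rw [← Finset.sum_sub_distrib]
      refine Finset.sum_congr rfl fun n _ => ?_
      rw [hVU, show (n:ℝ) * c - (c + 1 + 3) / 2 = -1 + ((n:ℝ) * c - (c + 1 + 1) / 2) by ring,
        Real.rpow_add hx, Real.rpow_neg_one]
      ring
    rw [hθ x hx, ← intervalIntegral.integral_of_le hx.le, hsumV, hR, hD]
    change _ - _ * I x - _ = _
    linear_combination (-(c / (c + 1))) * hsumD - (c / (c + 1)) * htel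
  have hmain : (fun x => c * (x⁻¹ * R x) - c / (c + 1) * (x ^ (-1 - 1 / (c + 1)) * D x)
        - c / (c + 1) * U N * (x ^ ((N:ℝ) * c - (c + 1 + 3) / 2) * E x)) =O[𝓝[>] (0:ℝ)]
      fun x => x ^ ((N:ℝ) * c - (c + 1 + 3) / 2) * E x := by
    refine IsBigO.sub (IsBigO.sub (IsBigO.const_mul_left ?_ _) (IsBigO.const_mul_left ?_ _))
      ((isBigO_refl _ _).const_mul_left _)
    · refine ((isBigO_refl (fun x : ℝ => x⁻¹) _).mul hRO).congr' EventuallyEq.rfl ?_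
      filter_upwards [self_mem_nhdsWithin] with x hx
      rw [show (N:ℝ) * c - (c + 1 + 3) / 2 = -1 + ((N:ℝ) * c - (c + 1 + 1) / 2) by ring,
        Real.rpow_add hx, Real.rpow_neg_one]
      ring
    · have h := (isBigO_refl (fun x : ℝ => x ^ (-1 - 1 / (c + 1))) (𝓝[>] 0)).mul hDO
      refine h.trans ?_
      refine IsBigO.of_bound 1 ?_
      filter_upwards [Ioo_mem_nhdsGT zero_lt_one] with x hx
      have hx0 : 0 < x := hx.1
      rw [one_mul, ← mul_assoc, ← Real.rpow_add hx0, hrθ]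
      simp only [norm_mul]
      gcongr
      rw [Real.norm_of_nonneg (by positivity), Real.norm_of_nonneg (by positivity)]
      refine Real.rpow_le_rpow_of_exponent_ge hx0 hx.2.le ?_
      push_cast
      linarith
  refine hmain.congr' ?_ ?_
  · filter_upwards [self_mem_nhdsWithin] with x hx
    rw [hexp x hx, hθD x hx]
  · filter_upwards [self_mem_nhdsWithin] with x hx
    rw [hexp x hx]
end

section
/- The function z ↦ 1 − w(z) − (γ−1) z w'(z) is Lebesgue integrable on (0,∞) and ∫_0^∞ ( 1 − w(z) − (γ−1) z w'(z) ) dz = γ ∫_1^∞ (u−1)(u^{γ−1}−1)/(u^γ−1)² du = ∫_0^1 v^{−1/γ} (1 − v^{1/γ})(1 − v^{(γ−1)/γ}) (1−v)^{−2} dv, all these integrals being finite. -/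
open MeasureTheory

/-- Interchange of integrals on the region `a < u < s`. -/
theorem integrableOn_tail_and_integral_tail {a : ℝ} {h : ℝ → ℝ} (hm : Measurable h)
    (hh : ∀ s ∈ Set.Ioi a, 0 ≤ h s) (hi : IntegrableOn (fun s => (s - a) * h s) (Set.Ioi a)) :
    IntegrableOn (fun u => ∫ s in Set.Ioi u, h s) (Set.Ioi a) ∧
      (∫ u in Set.Ioi a, ∫ s in Set.Ioi u, h s) = ∫ s in Set.Ioi a, (s - a) * h s := by
  let f : ℝ × ℝ → ℝ := {p : ℝ × ℝ | p.1 < p.2}.indicator fun p => h p.2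
  have hf_left (s u : ℝ) : f (u, s) = (Set.Iio s).indicator (fun _ => h s) u := by
    simp [f, Set.indicator]
  have hf_right (u s : ℝ) : f (u, s) = (Set.Ioi u).indicator h s := by
    simp [f, Set.indicator]
  have hf_meas : Measurable f :=
    (hm.comp measurable_snd).indicator (measurableSet_lt measurable_fst measurable_snd)
  have hslice (s : ℝ) (hs : s ∈ Set.Ioi a) : (∫ u in Set.Ioi a, f (u, s)) = (s - a) * h s := by
    simp_rw [hf_left]
    rw [setIntegral_indicator measurableSet_Iio, Set.Ioi_inter_Iio, setIntegral_const]
    simp [Measure.real, Real.volume_Ioo, ENNReal.toReal_ofReal (sub_nonneg.2 (le_of_lt hs))]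
  have hf_int : Integrable f
      ((volume.restrict (Set.Ioi a)).prod (volume.restrict (Set.Ioi a))) := by
    rw [integrable_prod_iff' hf_meas.aestronglyMeasurable]
    refine ⟨Filter.Eventually.of_forall fun s => ?_, ?_⟩
    · simp_rw [hf_left]
      rw [integrable_indicator_iff measurableSet_Iio, IntegrableOn,
        Measure.restrict_restrict measurableSet_Iio, Set.inter_comm, Set.Ioi_inter_Iio]
      exact integrable_const _
    · refine IntegrableOn.congr_fun hi (fun s hs => ?_) measurableSet_Ioi
      rw [← hslice s hs]
      congr 1
      ext u
      rw [hf_left, Real.norm_of_nonneg (Set.indicator_nonneg (fun _ _ => hh s hs) u)]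
  have htail (u : ℝ) (hu : u ∈ Set.Ioi a) :
      (∫ s in Set.Ioi a, f (u, s)) = ∫ s in Set.Ioi u, h s := by
    simp_rw [hf_right]
    rw [setIntegral_indicator measurableSet_Ioi, Set.inter_eq_right.2
      (Set.Ioi_subset_Ioi (le_of_lt hu))]
  refine ⟨IntegrableOn.congr_fun hf_int.integral_prod_left htail measurableSet_Ioi, ?_⟩
  rw [← setIntegral_congr_fun measurableSet_Ioi htail,
    integral_integral_swap (f := fun u s => f (u, s)) hf_int]
  exact setIntegral_congr_fun measurableSet_Ioi hslice

theorem integrableOn_Ioi_inv_rpow_sub_one {γ a : ℝ} (hγ : 1 < γ) (ha : 1 < a) :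
    IntegrableOn (fun u : ℝ => (u ^ γ - 1)⁻¹) (Set.Ioi a) := by
  have hc : 1 < a ^ γ := Real.one_lt_rpow ha (by linarith)
  refine Integrable.mono' (((integrableOn_Ioi_rpow_of_lt (a := -γ) (by linarith)
    (zero_lt_one.trans ha)).const_mul (1 - (a ^ γ)⁻¹)⁻¹)) (by fun_prop) ?_
  refine (ae_restrict_iff' measurableSet_Ioi).2 (.of_forall fun u (hu : a < u) => ?_)
  have hu0 : 0 < u := by linarith
  have hau : a ^ γ < u ^ γ := Real.rpow_lt_rpow (by linarith) hu (by linarith)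
  have hc' : 0 < 1 - (a ^ γ)⁻¹ := sub_pos.2 (inv_lt_one_of_one_lt₀ hc)
  rw [Real.norm_of_nonneg (inv_nonneg.2 (by linarith)), Real.rpow_neg hu0.le, ← mul_inv]
  refine inv_anti₀ (mul_pos hc' (by linarith)) ?_
  have : 1 ≤ (a ^ γ)⁻¹ * u ^ γ := by
    rw [inv_mul_eq_div, one_le_div (by linarith)]
    exact hau.le
  linarith

theorem strictAntiOn_integral_Ioi_inv_rpow_sub_one {γ : ℝ} (hγ : 1 < γ) :
    StrictAntiOn (fun a : ℝ => ∫ u in Set.Ioi a, (u ^ γ - 1)⁻¹) (Set.Ioi 1) := by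
  intro a (ha : 1 < a) b (hb : 1 < b) hab
  have hia := integrableOn_Ioi_inv_rpow_sub_one hγ ha
  have hpos : 0 < ∫ u in a..b, (u ^ γ - 1)⁻¹ := by
    refine intervalIntegral.intervalIntegral_pos_of_pos_on ?_ (fun u hu => ?_) hab
    · rw [intervalIntegrable_iff_integrableOn_Ioc_of_le hab.le]
      exact hia.mono_set Set.Ioc_subset_Ioi_self
    · exact inv_pos.2 (sub_pos.2 (Real.one_lt_rpow (ha.trans hu.1) (by linarith)))
  rw [← intervalIntegral.integral_Ioi_sub_Ioi hia hab.le] at hpos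
  exact sub_pos.1 hpos

theorem integral_Ioi_inv_rpow_sub_one_pos {γ a : ℝ} (hγ : 1 < γ) (ha : 1 < a) :
    0 < ∫ u in Set.Ioi a, (u ^ γ - 1)⁻¹ := by
  refine lt_of_le_of_lt ?_ (strictAntiOn_integral_Ioi_inv_rpow_sub_one hγ ha
    (show a + 1 ∈ Set.Ioi 1 by simp; linarith) (lt_add_one a))
  refine setIntegral_nonneg measurableSet_Ioi fun u hu => inv_nonneg.2 (sub_nonneg.2 ?_)
  exact Real.one_le_rpow (by linarith [Set.mem_Ioi.1 hu]) (by linarith)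

theorem integrableOn_Ioi_sub_one_mul_rpow_sub_one_div_sq {γ : ℝ} (hγ : 1 < γ) :
    IntegrableOn (fun u : ℝ => (u - 1) * (u ^ (γ - 1) - 1) / (u ^ γ - 1) ^ 2) (Set.Ioi 1) := by
  have hpow (u : ℝ) (hu : 1 < u) : u ^ γ = u * u ^ (γ - 1) := by
    rw [← Real.rpow_one_add' (by linarith) (by linarith)]; ring_nf
  rw [← Set.Ioc_union_Ioi_eq_Ioi (one_le_two : (1 : ℝ) ≤ 2)]
  refine IntegrableOn.union ?_ ?_
  · refine Integrable.mono' (integrable_const (1 : ℝ))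
      (Measurable.aestronglyMeasurable (by fun_prop)) ?_
    refine (ae_restrict_iff' measurableSet_Ioc).2 (.of_forall fun u hu => ?_)
    have hu1 : 1 < u := hu.1
    have h1 : 1 < u ^ (γ - 1) := Real.one_lt_rpow hu1 (by linarith)
    have h2 : u < u * u ^ (γ - 1) := by nlinarith
    have h3 : u ^ (γ - 1) < u * u ^ (γ - 1) := by nlinarith
    rw [hpow u hu1, Real.norm_of_nonneg (by
      exact div_nonneg (mul_nonneg (by linarith) (by linarith)) (sq_nonneg _)),
      div_le_one (by apply pow_pos; linarith), sq]
    exact mul_le_mul (by linarith) (by linarith) (by linarith) (by linarith)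
  · refine Integrable.mono' (integrableOn_Ioi_inv_rpow_sub_one hγ one_lt_two)
      (Measurable.aestronglyMeasurable (by fun_prop)) ?_
    refine (ae_restrict_iff' measurableSet_Ioi).2 (.of_forall fun u (hu : 2 < u) => ?_)
    have hu1 : 1 < u := by linarith
    have h1 : 1 < u ^ (γ - 1) := Real.one_lt_rpow hu1 (by linarith)
    have h2 : 0 < u * u ^ (γ - 1) - 1 := by nlinarith
    rw [hpow u hu1, Real.norm_of_nonneg (by
      exact div_nonneg (mul_nonneg (by linarith) (by linarith)) (sq_nonneg _)),
      div_le_iff₀ (pow_pos h2 2), sq, inv_mul_cancel_left₀ h2.ne']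
    nlinarith

theorem tendsto_sub_one_div_rpow_sub_one_atTop {γ : ℝ} (hγ : 1 < γ) :
    Filter.Tendsto (fun u : ℝ => (u - 1) / (u ^ γ - 1)) Filter.atTop (nhds 0) := by
  have hlim : Filter.Tendsto (fun u : ℝ => (u ^ (γ - 1) - 1)⁻¹) Filter.atTop (nhds 0) :=
    (Filter.tendsto_atTop_add_const_right _ (-1 : ℝ)
      (tendsto_rpow_atTop (by linarith : 0 < γ - 1))).inv_tendsto_atTop
  refine squeeze_zero' ?_ ?_ hlim <;> filter_upwards [Filter.eventually_gt_atTop 1] with u hu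
  · exact div_nonneg (by linarith) (sub_nonneg.2 (Real.one_le_rpow hu.le (by linarith)))
  · have h1 : 1 < u ^ (γ - 1) := Real.one_lt_rpow hu (by linarith)
    have hpow : u ^ γ = u * u ^ (γ - 1) := by
      rw [← Real.rpow_one_add' (by linarith) (by linarith)]; ring_nf
    have h2 : 0 < u * u ^ (γ - 1) - 1 := by nlinarith
    rw [hpow, div_le_iff₀ h2, inv_mul_eq_div, le_div_iff₀ (by linarith)]
    nlinarith

theorem integral_Ioi_rpow_sub_one_div_sq {γ a : ℝ} (hγ : 1 < γ) (ha : 1 < a) :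
    (∫ s in Set.Ioi a, γ * ((s ^ (γ - 1) - 1) / (s ^ γ - 1) ^ 2)) =
      (γ - 1) * (∫ s in Set.Ioi a, (s ^ γ - 1)⁻¹) - (a - 1) / (a ^ γ - 1) := by
  have hinv := integrableOn_Ioi_inv_rpow_sub_one hγ ha
  have hpow (u : ℝ) (hu : 1 < u) : u ^ γ = u * u ^ (γ - 1) := by
    rw [← Real.rpow_one_add' (by linarith) (by linarith)]; ring_nf
  have hint : IntegrableOn (fun s : ℝ => γ * ((s ^ (γ - 1) - 1) / (s ^ γ - 1) ^ 2))
      (Set.Ioi a) := by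
    refine Integrable.mono' (hinv.const_mul γ)
      (Measurable.aestronglyMeasurable (by fun_prop)) ?_
    refine (ae_restrict_iff' measurableSet_Ioi).2 (.of_forall fun s (hs : a < s) => ?_)
    have hs1 : 1 < s := by linarith
    have h1 : 1 < s ^ (γ - 1) := Real.one_lt_rpow hs1 (by linarith)
    have h2 : 0 < s * s ^ (γ - 1) - 1 := by nlinarith
    rw [hpow s hs1, Real.norm_of_nonneg (by
      exact mul_nonneg (by linarith) (div_nonneg (by linarith) (sq_nonneg _)))]
    refine mul_le_mul_of_nonneg_left ?_ (by linarith)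
    rw [div_le_iff₀ (pow_pos h2 2), sq, inv_mul_cancel_left₀ h2.ne']
    nlinarith
  have hderiv (s : ℝ) (hs : 1 < s) : HasDerivAt (fun u : ℝ => (u - 1) / (u ^ γ - 1))
      (γ * ((s ^ (γ - 1) - 1) / (s ^ γ - 1) ^ 2) - (γ - 1) * (s ^ γ - 1)⁻¹) s := by
    have hne : s ^ γ - 1 ≠ 0 := (sub_pos.2 (Real.one_lt_rpow hs (by linarith))).ne'
    refine (((hasDerivAt_id s).sub_const 1).div
      ((Real.hasDerivAt_rpow_const (p := γ) (Or.inl (by linarith))).sub_const 1) hne).congr_deriv ?_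
    rw [hpow s hs] at hne ⊢
    simp only [id]
    field_simp
    ring
  have hftc := integral_Ioi_of_hasDerivAt_of_tendsto'
    (fun s (hs : a ≤ s) => hderiv s (ha.trans_le hs)) (hint.sub (hinv.const_mul (γ - 1)))
    (tendsto_sub_one_div_rpow_sub_one_atTop hγ)
  rw [integral_sub hint (hinv.const_mul (γ - 1)), integral_const_mul (γ - 1)] at hftc
  linarith

theorem image_rpow_neg_inv_Ioo {γ : ℝ} (hγ : 0 < γ) :
    (fun v : ℝ => v ^ (-1 / γ)) '' Set.Ioo 0 1 = Set.Ioi 1 := by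
  ext u
  constructor
  · rintro ⟨v, hv, rfl⟩
    exact Real.one_lt_rpow_of_pos_of_lt_one_of_neg hv.1 hv.2 (div_neg_of_neg_of_pos (by simp) hγ)
  · intro (hu : 1 < u)
    have hu0 : 0 < u := by linarith
    refine ⟨u ^ (-γ), ⟨Real.rpow_pos_of_pos hu0 _,
      Real.rpow_lt_one_of_one_lt_of_neg hu (by linarith)⟩, ?_⟩
    dsimp only
    rw [← Real.rpow_mul hu0.le, show -γ * (-1 / γ) = 1 by field_simp, Real.rpow_one]

theorem injOn_rpow_neg_inv_Ioo {γ : ℝ} (hγ : 0 < γ) :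
    Set.InjOn (fun v : ℝ => v ^ (-1 / γ)) (Set.Ioo 0 1) := by
  intro x hx y hy hxy
  exact (Real.rpow_left_inj hx.1.le hy.1.le (div_neg_of_neg_of_pos (by simp) hγ).ne).1 hxy

theorem abs_deriv_rpow_smul_comp {γ v : ℝ} (hγ : 1 < γ) (hv : v ∈ Set.Ioo (0 : ℝ) 1) :
    |(-1 / γ) * v ^ (-1 / γ - 1)| • (γ * (((v ^ (-1 / γ)) - 1) *
      ((v ^ (-1 / γ)) ^ (γ - 1) - 1) / ((v ^ (-1 / γ)) ^ γ - 1) ^ 2)) =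
    v ^ (-1/γ) * (1 - v ^ (1/γ)) * (1 - v ^ ((γ - 1)/γ)) / (1 - v) ^ 2 := by
  have hv0 := hv.1
  have hγ0 : 0 < γ := by linarith
  have hr : 0 < v ^ (1 / γ) := Real.rpow_pos_of_pos hv0 _
  have h1v : 1 - v ≠ 0 := (sub_pos.2 hv.2).ne'
  have e1 : v ^ (-1 / γ) = (v ^ (1 / γ))⁻¹ := by rw [neg_div, Real.rpow_neg hv0.le]
  have e2 : (v ^ (-1 / γ)) ^ γ = v⁻¹ := by
    rw [← Real.rpow_mul hv0.le, div_mul_cancel₀ _ hγ0.ne', Real.rpow_neg_one]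
  have e3 : v ^ (-1 / γ - 1) = (v ^ (1 / γ))⁻¹ * v⁻¹ := by
    rw [Real.rpow_sub_one hv0.ne', e1, div_eq_mul_inv]
  have e4 : v ^ ((γ - 1) / γ) = v / v ^ (1 / γ) := by
    rw [show (γ - 1) / γ = 1 - 1 / γ by field_simp, Real.rpow_sub hv0, Real.rpow_one]
  have e5 : (v ^ (-1 / γ)) ^ (γ - 1) = v ^ (1 / γ) / v := by
    rw [Real.rpow_sub_one (Real.rpow_pos_of_pos hv0 _).ne', e2, e1]
    field_simp
  rw [e2, e5, e3, e4, e1, abs_mul, neg_div, abs_neg, abs_of_pos (by positivity : 0 < 1 / γ),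
    abs_of_pos (by positivity), smul_eq_mul]
  have h2 : v⁻¹ - 1 ≠ 0 := by
    rw [show v⁻¹ - 1 = (1 - v) / v by field_simp]
    exact div_ne_zero h1v hv0.ne'
  rw [show v⁻¹ - 1 = (1 - v) / v by field_simp]
  generalize v ^ (1 / γ) = r at *
  field_simp


/-- Fix `γ ∈ (1,2]` and let `w` be the unique decreasing function
with `∫_{w(y)}^∞ du/(u^γ − 1) = y` and `w'(y) = −(w(y)^γ − 1)`.  Then
`z ↦ 1 − w(z) − (γ−1) z w'(z)` is Lebesgue integrable on `(0,∞)` and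
`∫_0^∞ (1 − w(z) − (γ−1) z w'(z)) dz = γ ∫_1^∞ (u−1)(u^{γ−1}−1)/(u^γ−1)² du
  = ∫_0^1 v^{−1/γ} (1 − v^{1/γ})(1 − v^{(γ−1)/γ})(1−v)^{−2} dv`,
all these integrals being finite. -/
theorem stmt19 (γ : ℝ) (hγ1 : 1 < γ) (hγ2 : γ ≤ 2)
    (w : ℝ → ℝ)
    (hw_gt : ∀ y ∈ Set.Ioi (0:ℝ), 1 < w y)
    (hw_int : ∀ y ∈ Set.Ioi (0:ℝ), (∫ u in Set.Ioi (w y), (u ^ γ - 1)⁻¹) = y)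
    (hw_deriv : ∀ y ∈ Set.Ioi (0:ℝ), HasDerivAt w (-(w y ^ γ - 1)) y) :
    IntegrableOn (fun z : ℝ => 1 - w z - (γ - 1) * z * deriv w z) (Set.Ioi 0) ∧
    IntegrableOn (fun u : ℝ => (u - 1) * (u ^ (γ - 1) - 1) / (u ^ γ - 1) ^ 2) (Set.Ioi 1) ∧
    IntegrableOn
      (fun v : ℝ => v ^ (-1/γ) * (1 - v ^ (1/γ)) * (1 - v ^ ((γ - 1)/γ)) / (1 - v) ^ 2)
      (Set.Ioo 0 1) ∧
    (∫ z in Set.Ioi (0:ℝ), (1 - w z - (γ - 1) * z * deriv w z))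
      = γ * (∫ u in Set.Ioi (1:ℝ), (u - 1) * (u ^ (γ - 1) - 1) / (u ^ γ - 1) ^ 2) ∧
    (∫ z in Set.Ioi (0:ℝ), (1 - w z - (γ - 1) * z * deriv w z))
      = ∫ v in Set.Ioo (0:ℝ) 1,
          v ^ (-1/γ) * (1 - v ^ (1/γ)) * (1 - v ^ ((γ - 1)/γ)) / (1 - v) ^ 2 := by
  have hγ0 : 0 < γ := by linarith
  have hbase := integrableOn_Ioi_sub_one_mul_rpow_sub_one_div_sq hγ1
  have hK := hbase.const_mul γ
  have hK_eq : (fun s : ℝ => (s - 1) * (γ * ((s ^ (γ - 1) - 1) / (s ^ γ - 1) ^ 2))) =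
      fun u => γ * ((u - 1) * (u ^ (γ - 1) - 1) / (u ^ γ - 1) ^ 2) := by
    ext s; ring
  obtain ⟨htail_int, htail_eq⟩ := integrableOn_tail_and_integral_tail (a := 1)
    (h := fun s : ℝ => γ * ((s ^ (γ - 1) - 1) / (s ^ γ - 1) ^ 2)) (by fun_prop)
    (fun s (hs : 1 < s) => mul_nonneg hγ0.le (div_nonneg
      (sub_nonneg.2 (Real.one_le_rpow hs.le (by linarith))) (sq_nonneg _)))
    (by rw [hK_eq]; exact hK)
  rw [hK_eq, integral_const_mul] at htail_eq
  have hw_inj : Set.InjOn w (Set.Ioi 0) := fun x hx y hy hxy => by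
    rw [← hw_int x hx, ← hw_int y hy, hxy]
  have hw_image : w '' Set.Ioi 0 = Set.Ioi 1 := by
    refine Set.Subset.antisymm (Set.image_subset_iff.2 hw_gt) fun u hu => ?_
    have hy := integral_Ioi_inv_rpow_sub_one_pos hγ1 hu
    exact ⟨_, hy, (strictAntiOn_integral_Ioi_inv_rpow_sub_one hγ1).injOn (hw_gt _ hy) hu
      (hw_int _ hy)⟩
  have hw_within : ∀ y ∈ Set.Ioi (0 : ℝ),
      HasDerivWithinAt w (-(w y ^ γ - 1)) (Set.Ioi 0) y :=
    fun y hy => (hw_deriv y hy).hasDerivWithinAt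
  have hF : Set.EqOn (fun z => |-(w z ^ γ - 1)| •
      ∫ s in Set.Ioi (w z), γ * ((s ^ (γ - 1) - 1) / (s ^ γ - 1) ^ 2))
      (fun z => 1 - w z - (γ - 1) * z * deriv w z) (Set.Ioi 0) := by
    intro z hz
    have hpos : 0 < w z ^ γ - 1 := sub_pos.2 (Real.one_lt_rpow (hw_gt z hz) hγ0)
    dsimp only
    rw [integral_Ioi_rpow_sub_one_div_sq hγ1 (hw_gt z hz), hw_int z hz, (hw_deriv z hz).deriv,
      abs_neg, abs_of_pos hpos, smul_eq_mul]
    field_simp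
    ring
  have hF_int := (integrableOn_image_iff_integrableOn_abs_deriv_smul measurableSet_Ioi
    hw_within hw_inj _).1 (hw_image ▸ htail_int)
  have hF_eq := integral_image_eq_integral_abs_deriv_smul measurableSet_Ioi hw_within hw_inj
    (fun u => ∫ s in Set.Ioi u, γ * ((s ^ (γ - 1) - 1) / (s ^ γ - 1) ^ 2))
  rw [hw_image, htail_eq, setIntegral_congr_fun measurableSet_Ioi hF] at hF_eq
  have hv_within : ∀ v ∈ Set.Ioo (0 : ℝ) 1, HasDerivWithinAt (fun v : ℝ => v ^ (-1 / γ))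
      ((-1 / γ) * v ^ (-1 / γ - 1)) (Set.Ioo 0 1) v :=
    fun v hv => (Real.hasDerivAt_rpow_const (Or.inl hv.1.ne')).hasDerivWithinAt
  have hV_int := (integrableOn_image_iff_integrableOn_abs_deriv_smul measurableSet_Ioo
    hv_within (injOn_rpow_neg_inv_Ioo hγ0) _).1 ((image_rpow_neg_inv_Ioo hγ0).symm ▸ hK)
  have hV_eq := integral_image_eq_integral_abs_deriv_smul measurableSet_Ioo hv_within
    (injOn_rpow_neg_inv_Ioo hγ0)
    (fun u : ℝ => γ * ((u - 1) * (u ^ (γ - 1) - 1) / (u ^ γ - 1) ^ 2))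
  rw [image_rpow_neg_inv_Ioo hγ0, integral_const_mul,
    setIntegral_congr_fun measurableSet_Ioo fun v hv => abs_deriv_rpow_smul_comp hγ1 hv] at hV_eq
  exact ⟨hF_int.congr_fun hF measurableSet_Ioi, hbase,
    hV_int.congr_fun (fun v hv => abs_deriv_rpow_smul_comp hγ1 hv) measurableSet_Ioo,
    hF_eq.symm, hF_eq.symm.trans hV_eq⟩
end
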